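/- Sharp anisotropic L^p Sobolev trace inequality (Nazaret): let 1 < p < n and q = p/(p-1), and let C be even, convex, q-homogeneous and positive away from 0. Then for every smooth function f with compact support on ℝ^n, (∫_{∂ℝ^n_+} |f(0,x)|^{p(n-1)/(n-p)} dx)^{(n-p)/(n-1)} ≤ 𝒦_{n,C} ∫_{ℝ^n_+} C^*(∇f(t,x)) dx dt, where 𝒦_{n,C} = p^p (n-p)^{-p/q} (q(n-1))^{-p/(q(n-1))} (∫_{(K_C)_+} y_1^{qn-q-n} dy)^{-p/(q(n-1))}; moreover, extending both sides to all functions for which they are finite, equality holds for f(t,x) = γ · C(t+δ, x−x_0)^{-(n-p)/p} for any real constants γ and δ with δ > 0 and any point x_0 ∈ ℝ^{n-1}. -/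

import Mathlib

open MeasureTheory Real Set
open scoped RealInnerProductSpace ENNReal NNReal Pointwise

noncomputable section

namespace AffineTrace

/-- `ω s = π^(s/2) / Γ(s/2 + 1)` -/
def w (s : ℝ) : ℝ := Real.pi ^ (s / 2) / Real.Gamma (s / 2 + 1)

/-- the constant `c_{m,p} = (m ω_m)^{1/m} (m ω_m ω_{p-1} / (2 ω_{m+p-2}))^{1/p}` -/
def cc (m : ℕ) (p : ℝ) : ℝ :=
  ((m : ℝ) * w m) ^ ((m : ℝ)⁻¹) *
    ((m : ℝ) * w m * w (p - 1) / (2 * w ((m : ℝ) + p - 2))) ^ p⁻¹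

/-- the constant `a_{m,p} = ω_{m+p} / (ω_2 ω_m ω_{p-1})` -/
def aa (m : ℕ) (p : ℝ) : ℝ := w ((m : ℝ) + p) / (w 2 * w m * w (p - 1))

/-- the open half-space `ℝⁿ₊ = (0,∞) × ℝ^{n-1}` -/
def H (n : ℕ) : Set (ℝ × EuclideanSpace ℝ (Fin (n - 1))) := {y | 0 < y.1}

/-- `∂f/∂t`, the partial derivative in the `t`-variable -/
def dt {n : ℕ} (f : ℝ × EuclideanSpace ℝ (Fin (n - 1)) → ℝ)
    (y : ℝ × EuclideanSpace ℝ (Fin (n - 1))) : ℝ :=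
  fderiv ℝ f y (1, 0)

/-- `∇_ξ f = ∇̃f ⬝ ξ`, the directional derivative in the direction `(0, ξ)` -/
def dxi {n : ℕ} (f : ℝ × EuclideanSpace ℝ (Fin (n - 1)) → ℝ)
    (ξ : EuclideanSpace ℝ (Fin (n - 1))) (y : ℝ × EuclideanSpace ℝ (Fin (n - 1))) : ℝ :=
  fderiv ℝ f y (0, ξ)

/-- `∇̃f`, the gradient in the `x`-variable -/
def gradx {n : ℕ} (f : ℝ × EuclideanSpace ℝ (Fin (n - 1)) → ℝ)
    (y : ℝ × EuclideanSpace ℝ (Fin (n - 1))) : EuclideanSpace ℝ (Fin (n - 1)) :=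
  gradient (fun x => f (y.1, x)) y.2

/-- the `L^p` norm (w.r.t. Lebesgue measure) over the half-space `ℝⁿ₊` -/
def lp (n : ℕ) (p : ℝ) (g : ℝ × EuclideanSpace ℝ (Fin (n - 1)) → ℝ) : ℝ :=
  (∫ y in H n, |g y| ^ p) ^ p⁻¹

/-- the surface measure on the unit sphere `𝕊^{m-1}` of `ℝ^m` -/
def sphMeasure (m : ℕ) : Measure (Metric.sphere (0 : EuclideanSpace ℝ (Fin m)) 1) :=
  (volume : Measure (EuclideanSpace ℝ (Fin m))).toSphere

/-- `Z_p(f) = (∫_{𝕊^{n-2}} ‖∇_ξ f‖_p^{1-n} dξ)^{1/(1-n)}` -/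
def Z (n : ℕ) (p : ℝ) (f : ℝ × EuclideanSpace ℝ (Fin (n - 1)) → ℝ) : ℝ :=
  (∫ ξ, lp n p (dxi f (ξ : EuclideanSpace ℝ (Fin (n - 1)))) ^ (1 - (n : ℝ))
      ∂(sphMeasure (n - 1))) ^ (1 - (n : ℝ))⁻¹

/-- the affine energy `ℰ_p(f) = c_{n-1,p} Z_p(f)` -/
def Ep (n : ℕ) (p : ℝ) (f : ℝ × EuclideanSpace ℝ (Fin (n - 1)) → ℝ) : ℝ :=
  cc (n - 1) p * Z n p f

/-- the boundary trace integral `∫_{∂ℝⁿ₊} |f(0,x)|^r dx` -/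
def bdry (n : ℕ) (r : ℝ) (f : ℝ × EuclideanSpace ℝ (Fin (n - 1)) → ℝ) : ℝ :=
  ∫ x : EuclideanSpace ℝ (Fin (n - 1)), |f (0, x)| ^ r

/-- the duality pairing on `ℝ × ℝ^m` -/
def pairP {m : ℕ} (y z : ℝ × EuclideanSpace ℝ (Fin m)) : ℝ := y.1 * z.1 + ⟪y.2, z.2⟫

/-- the Legendre transform of a function on `ℝ × ℝ^m` -/
def legendreP {m : ℕ} (C : ℝ × EuclideanSpace ℝ (Fin m) → ℝ)
    (y : ℝ × EuclideanSpace ℝ (Fin m)) : ℝ :=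
  ⨆ z, (pairP y z - C z)

/-- the Legendre transform of a function on `ℝ^m` -/
def legendreE {m : ℕ} (C : EuclideanSpace ℝ (Fin m) → ℝ) (y : EuclideanSpace ℝ (Fin m)) : ℝ :=
  ⨆ z, (⟪y, z⟫ - C z)

/-- the `m`-dimensional volume of a subset of `ℝ^m`, as a real number -/
def vol {m : ℕ} (K : Set (EuclideanSpace ℝ (Fin m))) : ℝ := (volume K).toReal

/-- the support function of a subset of `ℝ^m` -/
def suppFn {m : ℕ} (K : Set (EuclideanSpace ℝ (Fin m))) (y : EuclideanSpace ℝ (Fin m)) : ℝ :=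
  sSup ((fun z => ⟪y, z⟫) '' K)

/-- the polar body of a subset of `ℝ^m` -/
def polar {m : ℕ} (K : Set (EuclideanSpace ℝ (Fin m))) : Set (EuclideanSpace ℝ (Fin m)) :=
  {y | ∀ z ∈ K, ⟪y, z⟫ ≤ 1}

/-- the `L_p`-centroid body `Γ_p K` of a convex body `K ⊂ ℝ^m`: the convex body whose
support function is `h(y) = ((a_{m,p} vol K)⁻¹ ∫_K |⟨y,z⟩|^p dz)^{1/p}` -/
def centroid (m : ℕ) (p : ℝ) (K : Set (EuclideanSpace ℝ (Fin m))) :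
    Set (EuclideanSpace ℝ (Fin m)) :=
  {x | ∀ y, ⟪x, y⟫ ≤ ((aa m p * vol K)⁻¹ * ∫ z in K, |⟪y, z⟫| ^ p) ^ p⁻¹}

/-- the convex body `L_f = {ξ : ‖∇_ξ f‖_p ≤ 1}` in `ℝ^{n-1}` -/
def Lbody (n : ℕ) (p : ℝ) (f : ℝ × EuclideanSpace ℝ (Fin (n - 1)) → ℝ) :
    Set (EuclideanSpace ℝ (Fin (n - 1))) :=
  {ξ | lp n p (dxi f ξ) ≤ 1}

/-- the constant `α_f = (p/(p-1)) ‖∂f/∂t‖_p^{-p} Z_p(f)^{1-n}` -/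
def alpha (n : ℕ) (p : ℝ) (f : ℝ × EuclideanSpace ℝ (Fin (n - 1)) → ℝ) : ℝ :=
  p / (p - 1) * lp n p (dt f) ^ (-p) * Z n p f ^ (1 - (n : ℝ))

/-- `D_f^*(x) = ∫_{𝕊^{n-2}} ‖∇_ξ f‖_p^{1-n-p} |⟨x,ξ⟩|^p dξ` -/
def Dstar (n : ℕ) (p : ℝ) (f : ℝ × EuclideanSpace ℝ (Fin (n - 1)) → ℝ)
    (x : EuclideanSpace ℝ (Fin (n - 1))) : ℝ :=
  ∫ ξ, lp n p (dxi f (ξ : EuclideanSpace ℝ (Fin (n - 1)))) ^ (1 - (n : ℝ) - p) *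
      |⟪x, (ξ : EuclideanSpace ℝ (Fin (n - 1)))⟫| ^ p ∂(sphMeasure (n - 1))

/-- `C_f^*(t,x) = (α_f/p)|t|^p + D_f^*(x)` -/
def Cstar (n : ℕ) (p : ℝ) (f : ℝ × EuclideanSpace ℝ (Fin (n - 1)) → ℝ)
    (y : ℝ × EuclideanSpace ℝ (Fin (n - 1))) : ℝ :=
  alpha n p f / p * |y.1| ^ p + Dstar n p f y.2

/-- `C_f`, the Legendre transform of `C_f^*` -/
def Cf (n : ℕ) (p : ℝ) (f : ℝ × EuclideanSpace ℝ (Fin (n - 1)) → ℝ) :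
    ℝ × EuclideanSpace ℝ (Fin (n - 1)) → ℝ :=
  legendreP (Cstar n p f)

/-- the convex body `K_f = {y : C_f(y) ≤ 1}` in `ℝⁿ` -/
def Kf (n : ℕ) (p : ℝ) (f : ℝ × EuclideanSpace ℝ (Fin (n - 1)) → ℝ) :
    Set (ℝ × EuclideanSpace ℝ (Fin (n - 1))) :=
  {y | Cf n p f y ≤ 1}

/-- the slice `K_{f,t} = {x : (t,x) ∈ K_f}` -/
def slice (n : ℕ) (p : ℝ) (f : ℝ × EuclideanSpace ℝ (Fin (n - 1)) → ℝ) (t : ℝ) :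
    Set (EuclideanSpace ℝ (Fin (n - 1))) :=
  {x | (t, x) ∈ Kf n p f}

/-- the sharp constant `𝒦_n` of the `L²` Sobolev trace inequality -/
def Kn (n : ℕ) : ℝ :=
  1 / (Real.sqrt Real.pi * ((n : ℝ) - 2)) *
    (Real.Gamma n / (((n : ℝ) - 1) * Real.Gamma (((n : ℝ) - 1) / 2))) ^ (((n : ℝ) - 1)⁻¹)

/-- the sharp constant `𝒜_{n,p}` of the affine `L^p` Sobolev trace inequality -/
def A (n : ℕ) (p : ℝ) : ℝ :=
  Real.pi ^ (-(p - 1) / 2) * ((p - 1) ^ ((p - 1) / p) / ((n : ℝ) - p)) ^ (p - 1) *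
    (Real.Gamma n * Real.Gamma (((n : ℝ) + 1) / 2) /
      (((n : ℝ) - 1) * Real.Gamma (((n : ℝ) - 1) / p) *
        Real.Gamma (((n : ℝ) * (p - 1) + 1) / p))) ^ ((p - 1) / ((n : ℝ) - 1))

/-- Monotone rearrangement on the line: a continuous compactly supported density is transported
onto a continuous positive density on an interval by a differentiable map. -/
theorem exists_monotone_transport {F B : ℝ → ℝ} (hF : Continuous F) (hFs : HasCompactSupport F)
    (hF0 : ∀ x, 0 ≤ F x) (hB : Continuous B) (hB0 : ∀ x, 0 < B x) {R : ℝ} (hR : 0 < R)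
    (hFB : ∫ x, F x = ∫ y in (-R)..R, B y) :
    ∃ T : ℝ → ℝ, ∀ x, HasDerivAt T (F x / B (T x)) x := by
  obtain ⟨m, hm, hmB⟩ : ∃ m, 0 < m ∧ ∀ y ∈ Icc (-R) R, m ≤ B y := by
    obtain ⟨y, -, hy⟩ := (isCompact_Icc (a := -R) (b := R)).exists_isMinOn
      ⟨0, by constructor <;> linarith⟩ hB.continuousOn
    exact ⟨B y, hB0 y, fun z hz => hy hz⟩
  set D : ℝ → ℝ := fun y => B (max (-R) (min R y)) with hD
  have hDc : Continuous D := by fun_prop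
  have hDm : ∀ y, m ≤ D y := fun y =>
    hmB _ ⟨le_max_left _ _, max_le (by linarith) (min_le_left _ _)⟩
  have hDB : ∀ y ∈ Icc (-R) R, D y = B y := fun y hy => by
    simp only [hD]; rw [min_eq_right hy.2, max_eq_right hy.1]
  set Φ : ℝ → ℝ := fun y => ∫ s in (-R)..y, D s with hΦ
  have hΦd : ∀ y, HasDerivAt Φ (D y) y := fun y =>
    intervalIntegral.integral_hasDerivAt_right (hDc.intervalIntegrable _ _)
      (hDc.stronglyMeasurableAtFilter _ _) hDc.continuousAt
  have hΦmono : StrictMono Φ := strictMono_of_deriv_pos fun y => by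
    rw [(hΦd y).deriv]; exact hm.trans_le (hDm y)
  have hΦc : Continuous Φ := continuous_iff_continuousAt.2 fun y => (hΦd y).continuousAt
  have hlin : Monotone fun y => Φ y - m * y := monotone_of_deriv_nonneg
    (fun y => ((hΦd y).fun_sub ((hasDerivAt_id' y).const_mul m)).differentiableAt) fun y => by
      rw [((hΦd y).fun_sub ((hasDerivAt_id' y).const_mul m)).deriv]
      have := hDm y; linarith
  have hΦ0 : Φ (-R) = 0 := by simp [hΦ]
  have hΦsurj : Function.Surjective Φ := by
    refine hΦc.surjective ?_ ?_
    · refine Filter.tendsto_atTop_mono' _ ?_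
        (Filter.tendsto_atTop_add_const_right _ (m * R)
          (Filter.tendsto_id.const_mul_atTop hm))
      filter_upwards [Filter.eventually_ge_atTop (-R)] with y hy
      have := hlin hy
      simp only [hΦ0, id] at this ⊢
      linarith
    · refine Filter.tendsto_atBot_mono' _ ?_
        (Filter.tendsto_atBot_add_const_right _ (m * R)
          (Filter.tendsto_id.const_mul_atBot hm))
      filter_upwards [Filter.eventually_le_atBot (-R)] with y hy
      have := hlin hy
      simp only [hΦ0, id] at this ⊢
      linarith
  let e : ℝ ≃o ℝ := hΦmono.orderIsoOfSurjective Φ hΦsurj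
  have he : ∀ y, Φ (e.symm y) = y := fun y => e.apply_symm_apply y
  obtain ⟨a, b, hab⟩ : ∃ a b, ∀ x, F x ≠ 0 → x ∈ Icc a b := by
    obtain ⟨r, hr⟩ := hFs.isCompact.isBounded.subset_closedBall (0 : ℝ)
    refine ⟨-r, r, fun x hx => ?_⟩
    have := hr (subset_tsupport F hx)
    rwa [Real.closedBall_eq_Icc, zero_sub, zero_add] at this
  set E : ℝ → ℝ := fun x => ∫ s in a..x, F s with hE
  have hEd : ∀ x, HasDerivAt E (F x) x := fun y =>
    intervalIntegral.integral_hasDerivAt_right (hF.intervalIntegrable _ _)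
      (hF.stronglyMeasurableAtFilter _ _) hF.continuousAt
  have hEmono : Monotone E := monotone_of_deriv_nonneg (fun x => (hEd x).differentiableAt)
    fun x => by rw [(hEd x).deriv]; exact hF0 x
  have hE0 : ∀ x, 0 ≤ E x := fun x => by
    have h1 : E (min a x) = 0 := by
      refine intervalIntegral.integral_zero_ae ?_
      have : ∀ᵐ s : ℝ, s ≠ a := by simp [ae_iff]
      filter_upwards [this] with s hs hs'
      by_contra h
      have h1 := (hab s h).1
      rw [uIoc_of_ge (min_le_left _ _)] at hs'
      exact hs (le_antisymm hs'.2 h1)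
    rw [← h1]; exact hEmono (min_le_right _ _)
  have hE1 : ∀ x, E x ≤ ∫ x, F x := fun x => by
    refine (hEmono (le_max_left x (max a b))).trans ?_
    have h2 : a ≤ max x (max a b) := le_trans (le_max_left _ _) (le_max_right _ _)
    simp only [hE]
    rw [intervalIntegral.integral_of_le h2]
    exact setIntegral_le_integral (hF.integrable_of_hasCompactSupport hFs)
      (Filter.Eventually.of_forall hF0)
  have hΦR : Φ R = ∫ x, F x := by
    rw [hFB]
    refine intervalIntegral.integral_congr fun y hy => ?_
    rw [uIcc_of_le (by linarith)] at hy
    exact hDB y hy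
  refine ⟨fun x => e.symm (E x), fun x => ?_⟩
  have hmem : e.symm (E x) ∈ Icc (-R) R := by
    constructor
    · rw [← hΦmono.le_iff_le, he, hΦ0]; exact hE0 x
    · rw [← hΦmono.le_iff_le, he, hΦR]; exact hE1 x
  have h1 : HasDerivAt e.symm (D (e.symm (E x)))⁻¹ (E x) :=
    HasDerivAt.of_local_left_inverse e.symm.continuous.continuousAt (hΦd _)
      (hm.trans_le (hDm _)).ne' (Filter.Eventually.of_forall he)
  have h2 := h1.comp x (hEd x)
  rw [hDB _ hmem] at h2
  rw [mul_comm, ← div_eq_mul_inv] at h2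
  exact h2

theorem hasCompactSupport_slice {X : Type*} [TopologicalSpace X] [R1Space X]
    {g : ℝ × X → ℝ} (hgs : HasCompactSupport g) (t : ℝ) :
    HasCompactSupport fun x => g (t, x) :=
  HasCompactSupport.intro (hgs.isCompact.image continuous_snd) fun x hx => by
    by_contra h
    exact hx ⟨(t, x), subset_tsupport g h, rfl⟩

theorem hasCompactSupport_integral_slice {X : Type*} [TopologicalSpace X]
    [MeasurableSpace X] {μ : Measure X} {g : ℝ × X → ℝ} (hgs : HasCompactSupport g) :
    HasCompactSupport fun t => ∫ x, g (t, x) ∂μ := by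
  refine HasCompactSupport.intro (hgs.isCompact.image continuous_fst) fun t ht => ?_
  have : ∀ x, g (t, x) = 0 := fun x => by
    by_contra h
    exact ht ⟨(t, x), subset_tsupport g h, rfl⟩
  simp [this]

theorem continuous_integral_slice {X : Type*} [TopologicalSpace X] [T2Space X]
    [MeasurableSpace X] [OpensMeasurableSpace X] {μ : Measure X} [IsLocallyFiniteMeasure μ]
    {g : ℝ × X → ℝ} (hg : Continuous g)
    (hgs : HasCompactSupport g) : Continuous fun t => ∫ x, g (t, x) ∂μ := by
  have h1 := continuous_parametric_integral_of_continuous (μ := μ) (f := fun t x => g (t, x))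
    (by exact hg) (hgs.isCompact.image continuous_snd)
  convert h1 using 2 with t
  refine (setIntegral_eq_integral_of_forall_compl_eq_zero fun x hx => ?_).symm
  by_contra h
  exact hx ⟨(t, x), subset_tsupport g h, rfl⟩

theorem hasDerivAt_integral_slice {X : Type*} [NormedAddCommGroup X] [NormedSpace ℝ X]
    [MeasurableSpace X] [BorelSpace X] [SecondCountableTopology X] {μ : Measure X}
    [IsFiniteMeasureOnCompacts μ] {F : ℝ × X → ℝ} (hF : ContDiff ℝ 1 F)
    (hFs : HasCompactSupport F) (t : ℝ) :
    HasDerivAt (fun t => ∫ x, F (t, x) ∂μ) (∫ x, fderiv ℝ F (t, x) (1, 0) ∂μ) t := by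
  have hD : Continuous fun y => fderiv ℝ F y (1, 0) :=
    (hF.continuous_fderiv one_ne_zero).clm_apply continuous_const
  have hDs : HasCompactSupport fun y => fderiv ℝ F y (1, 0) := hFs.fderiv_apply ℝ _
  obtain ⟨M, hM⟩ := hD.bounded_above_of_compact_support hDs
  set K : Set X := Prod.snd '' tsupport F
  have hK : IsCompact K := hFs.isCompact.image continuous_snd
  have hz : ∀ s x, x ∉ K → fderiv ℝ F (s, x) (1, 0) = 0 := fun s x hx => by
    by_contra h
    refine hx ⟨(s, x), support_fderiv_subset ℝ (f := F) ?_, rfl⟩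
    intro h0
    exact h (by rw [h0]; rfl)
  refine (hasDerivAt_integral_of_dominated_loc_of_deriv_le (s := univ)
    (bound := K.indicator fun _ => M)
    (F' := fun t x => fderiv ℝ F (t, x) (1, 0)) Filter.univ_mem ?_ ?_ ?_ ?_ ?_ ?_).2
  · exact Filter.Eventually.of_forall fun s =>
      (hF.continuous.comp (Continuous.prodMk_right s)).aestronglyMeasurable
  · exact (hF.continuous.comp (Continuous.prodMk_right t)).integrable_of_hasCompactSupport
      (hasCompactSupport_slice hFs t)
  · exact (hD.comp (Continuous.prodMk_right t)).aestronglyMeasurable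
  · refine Filter.Eventually.of_forall fun x s _ => ?_
    by_cases hx : x ∈ K
    · rw [indicator_of_mem hx]; exact hM _
    · rw [indicator_of_notMem hx, hz s x hx, norm_zero]
  · exact (integrable_indicator_iff hK.measurableSet).2
      (integrableOn_const hK.measure_lt_top.ne)
  · refine Filter.Eventually.of_forall fun x s _ => ?_
    have h1 : HasDerivAt (fun r : ℝ => (r, x)) ((1 : ℝ), (0 : X)) s :=
      (hasDerivAt_id s).prodMk (hasDerivAt_const s x)
    exact ((hF.differentiable one_ne_zero (s, x)).hasFDerivAt.comp_hasDerivAt s h1)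


theorem fderiv_eq_zero_of_nonneg_of_eq_zero {X : Type*} [NormedAddCommGroup X] [NormedSpace ℝ X]
    {F : X → ℝ} (hF0 : ∀ x, 0 ≤ F x) {x : X} (hx : F x = 0) : fderiv ℝ F x = 0 :=
  IsLocalMin.fderiv_eq_zero (Filter.Eventually.of_forall fun y => by rw [hx]; exact hF0 y)

theorem measurePreserving_consEquivL (m : ℕ) :
    MeasurePreserving (Fin.consEquivL ℝ fun _ : Fin (m + 1) => ℝ) := by
  convert (volume_preserving_piFinSuccAbove (fun _ : Fin (m + 1) => ℝ) 0).symm using 1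
  ext y i
  refine Fin.cases ?_ (fun j => ?_) i <;> simp [Fin.consEquivL, MeasurableEquiv.piFinSuccAbove]

/-- An infinitesimal form of the Knothe transport of a density `F` to a density `G` on a cube:
`l` plays the role of the diagonal of the differential of the triangular transport map. -/
theorem integral_nonneg_of_triangular_transport (m : ℕ) {R : ℝ} (hR : 0 < R)
    {F G Ψ : (Fin m → ℝ) → ℝ} (hF : ContDiff ℝ 1 F) (hFs : HasCompactSupport F)
    (hF0 : ∀ x, 0 ≤ F x) (hG : Continuous G) (hG0 : ∀ z, 0 < G z)
    (hFG : ∫ x, F x = ∫ z in Icc (fun _ => -R) (fun _ => R), G z) (hΨ : Integrable Ψ)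
    (hΨ0 : ∀ x, F x = 0 → 0 ≤ Ψ x)
    (hΨF : ∀ x z (l : Fin m → ℝ), (∀ i, 0 < l i) → G z * ∏ i, l i = F x →
      -(fderiv ℝ F x z) - F x * ∑ i, l i ≤ Ψ x) :
    0 ≤ ∫ x, Ψ x := by
  induction m with
  | zero =>
    have hI : (Icc (fun _ => -R) (fun _ => R) : Set (Fin 0 → ℝ)) = univ := by
      ext x; simp
    have hint : ∀ h : (Fin 0 → ℝ) → ℝ, ∫ x, h x = h 0 := fun h => by
      rw [volume_pi, Measure.pi_of_empty _ 0, integral_dirac]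
    rw [hI, setIntegral_univ, hint, hint] at hFG
    rw [hint]
    have h1 := hΨF 0 0 0 (fun i => i.elim0) (by simpa using hFG.symm)
    rwa [map_zero, Finset.univ_eq_empty, Finset.sum_empty, mul_zero, neg_zero, sub_zero] at h1
  | succ m ih =>
    set e := Fin.consEquivL ℝ fun _ : Fin (m + 1) => ℝ with he
    have hem : MeasurePreserving e := measurePreserving_consEquivL m
    have hemb : MeasurableEmbedding e := e.toHomeomorph.measurableEmbedding
    have he0 : ∀ a (x : Fin m → ℝ), e (a, x) 0 = a := fun a x => rfl
    have hes : ∀ a (x : Fin m → ℝ) j, e (a, x) (Fin.succ j) = x j := fun a x j => rfl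
    set F' : ℝ × (Fin m → ℝ) → ℝ := fun y => F (e y) with hF'
    have hF'c : ContDiff ℝ 1 F' := hF.comp e.contDiff
    have hF's : HasCompactSupport F' := hFs.comp_homeomorph e.toHomeomorph
    have hF'0 : ∀ y, 0 ≤ F' y := fun y => hF0 _
    have hF'd : ∀ y v, fderiv ℝ F' y v = fderiv ℝ F (e y) (e v) := fun y v => by
      have := ((hF.differentiable one_ne_zero (e y)).hasFDerivAt.comp y e.hasFDerivAt).fderiv
      rw [show F' = F ∘ e from rfl, this]; rfl
    have hG'c : Continuous fun y => G (e y) := hG.comp e.continuous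
    set I : Set (Fin m → ℝ) := Icc (fun _ => -R) (fun _ => R) with hI
    have hIc : IsCompact I := isCompact_Icc
    set B : ℝ → ℝ := fun s => ∫ z in I, G (e (s, z)) with hB
    have hBc : Continuous B :=
      continuous_parametric_integral_of_continuous (f := fun s z => G (e (s, z))) hG'c hIc
    have hIv : (volume I) ≠ 0 := by
      rw [hI, Real.volume_Icc_pi]
      simp; intros; linarith
    have hB0 : ∀ s, 0 < B s := fun s => by
      have hc : Continuous fun z => G (e (s, z)) := hG'c.comp (Continuous.prodMk_right s)
      rw [hB, setIntegral_pos_iff_support_of_nonneg_ae]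
      · have : Function.support (fun z => G (e (s, z))) = univ :=
          eq_univ_of_forall fun z => (hG0 _).ne'
        rw [this, univ_inter]; exact pos_iff_ne_zero.2 hIv
      · exact Filter.Eventually.of_forall fun z => (hG0 _).le
      · exact hc.continuousOn.integrableOn_compact hIc
    set F₁ : ℝ → ℝ := fun s => ∫ x, F' (s, x) with hF₁
    have hF₁c : Continuous F₁ := continuous_integral_slice hF'c.continuous hF's
    have hF₁s : HasCompactSupport F₁ := hasCompactSupport_integral_slice hF's
    have hF₁0 : ∀ s, 0 ≤ F₁ s := fun s => integral_nonneg fun x => hF'0 _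
    set D₁ : ℝ → ℝ := fun s => ∫ x, fderiv ℝ F' (s, x) (1, 0) with hD₁
    have hF₁d : ∀ s, HasDerivAt F₁ (D₁ s) s := fun s => hasDerivAt_integral_slice hF'c hF's s
    have hDc : Continuous fun y => fderiv ℝ F' y (1, 0) :=
      (hF'c.continuous_fderiv one_ne_zero).clm_apply continuous_const
    have hDs : HasCompactSupport fun y => fderiv ℝ F' y (1, 0) := hF's.fderiv_apply ℝ _
    have hD₁c : Continuous D₁ := continuous_integral_slice hDc hDs
    have hD₁s : HasCompactSupport D₁ := hasCompactSupport_integral_slice hDs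
    have hFB : ∫ x, F₁ x = ∫ y in (-R)..R, B y := by
      have h1 : ∫ x, F₁ x = ∫ x, F x := by
        rw [← hem.integral_comp hemb]
        exact (integral_prod _ (hF'c.continuous.integrable_of_hasCompactSupport hF's)).symm
      have h2 : e ⁻¹' (Icc (fun _ => -R) (fun _ => R)) = Icc (-R) R ×ˢ I := by
        ext ⟨a, x⟩
        simp only [mem_preimage, mem_Icc, Pi.le_def, Fin.forall_fin_succ, mem_prod, hI, he0, hes]
        tauto
      rw [h1, hFG, ← hem.setIntegral_preimage_emb hemb, h2,
        intervalIntegral.integral_of_le (by linarith), ← integral_Icc_eq_integral_Ioc]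
      exact setIntegral_prod _ (hG'c.continuousOn.integrableOn_compact
        (isCompact_Icc.prod hIc))
    obtain ⟨T, hT⟩ := exists_monotone_transport hF₁c hF₁s hF₁0 hBc hB0 hR hFB
    have hTc : Continuous T := continuous_iff_continuousAt.2 fun y => (hT y).continuousAt
    have hΨ' : Integrable (fun y => Ψ (e y)) := (hem.integrable_comp_emb hemb).2 hΨ
    have key : ∀ s, Integrable (fun x => Ψ (e (s, x))) →
        -(D₁ s * T s + F₁ s * (F₁ s / B (T s))) ≤ ∫ x, Ψ (e (s, x)) := by
      intro s hs
      have hFsc : Continuous fun x => F' (s, x) :=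
        hF'c.continuous.comp (Continuous.prodMk_right s)
      rcases (hF₁0 s).eq_or_lt with h0 | hpos
      · have h1 : ∀ x, F' (s, x) = 0 := fun x => by
          by_contra h
          exact h0.not_lt (hFsc.integral_pos_of_hasCompactSupport_nonneg_nonzero
            (hasCompactSupport_slice hF's s) (fun x => hF'0 _) h)
        have h2 : D₁ s = 0 := integral_eq_zero_of_ae <| Filter.Eventually.of_forall fun x => by
          simp [fderiv_eq_zero_of_nonneg_of_eq_zero hF'0 (h1 x)]
        rw [h2, ← h0]
        simpa using integral_nonneg fun x => hΨ0 _ (h1 x)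
      · set L := F₁ s / B (T s) with hL
        have hL0 : 0 < L := div_pos hpos (hB0 _)
        have hDi : Integrable fun x => fderiv ℝ F' (s, x) (1, 0) :=
          (hDc.comp (Continuous.prodMk_right s)).integrable_of_hasCompactSupport
            (hasCompactSupport_slice hDs s)
        have hFi : Integrable fun x => F' (s, x) :=
          hFsc.integrable_of_hasCompactSupport (hasCompactSupport_slice hF's s)
        have hadd : ∀ x (a : ℝ) z, fderiv ℝ F' (s, x) (a, z)
            = fderiv ℝ F' (s, x) (1, 0) * a + fderiv ℝ F' (s, x) (0, z) := fun x a z => by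
          have : ((a, z) : ℝ × (Fin m → ℝ)) = a • (1, 0) + (0, z) := by simp
          rw [this, map_add, map_smul, smul_eq_mul, mul_comm]
        have := ih (F := fun x => F' (s, x)) (G := fun z => L * G (e (T s, z)))
          (Ψ := fun x => Ψ (e (s, x)) + fderiv ℝ F' (s, x) (1, 0) * T s + F' (s, x) * L)
          (hF'c.comp (contDiff_prodMk_right s)) (hasCompactSupport_slice hF's s)
          (fun x => hF'0 _) (continuous_const.mul (hG'c.comp (Continuous.prodMk_right _)))
          (fun z => mul_pos hL0 (hG0 _))
          (by rw [integral_const_mul]; exact (div_mul_cancel₀ _ (hB0 _).ne').symm)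
          ((hs.add (hDi.mul_const _)).add (hFi.mul_const _))
          (fun x hx => by
            have h1 : F' (s, x) = 0 := hx
            rw [h1, fderiv_eq_zero_of_nonneg_of_eq_zero hF'0 h1]
            simpa using hΨ0 _ h1)
          (fun x z l hl hlF => by
            have h1 := hΨF (e (s, x)) (e (T s, z)) (Fin.cons L l)
              (fun i => by refine Fin.cases ?_ (fun j => ?_) i <;> simp [hL0, hl])
              (by
                rw [Fin.prod_univ_succ]
                simp only [Fin.cons_zero, Fin.cons_succ]
                rw [← show _ = F (e (s, x)) from hlF]; ring)
            rw [← hF'd, hadd, Fin.sum_univ_succ] at h1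
            simp only [Fin.cons_zero, Fin.cons_succ] at h1
            have h2 : fderiv ℝ (fun x => F' (s, x)) x z = fderiv ℝ F' (s, x) (0, z) := by
              have := ((hF'c.differentiable one_ne_zero (s, x)).hasFDerivAt.comp x
                (hasFDerivAt_prodMk_right s x)).fderiv
              rw [show (fun x => F' (s, x)) = F' ∘ fun x => (s, x) from rfl, this]; rfl
            rw [h2]
            have h3 : F (e (s, x)) = F' (s, x) := rfl
            rw [h3] at h1
            linarith)
        rw [integral_add (by exact hs.add (hDi.mul_const _)) (hFi.mul_const _),
          integral_add hs (hDi.mul_const _), integral_mul_const, integral_mul_const] at this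
        change 0 ≤ (∫ x, Ψ (e (s, x))) + D₁ s * T s + F₁ s * L at this
        linarith
    have hzero : ∫ s, (D₁ s * T s + F₁ s * (F₁ s / B (T s))) = 0 := by
      refine integral_eq_zero_of_hasDerivAt_of_integrable (f := fun s => F₁ s * T s)
        (fun s => (hF₁d s).mul (hT s)) ?_ ?_
      · refine Integrable.add ?_ ?_
        · exact (hD₁c.mul hTc).integrable_of_hasCompactSupport hD₁s.mul_right
        · exact (hF₁c.mul (hF₁c.div (hBc.comp hTc)
            fun s => (hB0 _).ne')).integrable_of_hasCompactSupport hF₁s.mul_right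
      · exact (hF₁c.mul hTc).integrable_of_hasCompactSupport hF₁s.mul_right
    rw [← hem.integral_comp hemb, Measure.volume_eq_prod, integral_prod _ hΨ', ← neg_zero,
      ← hzero, ← integral_neg]
    refine integral_mono_ae ?_ hΨ'.integral_prod_left ?_
    · refine Integrable.neg (Integrable.add ?_ ?_)
      · exact (hD₁c.mul hTc).integrable_of_hasCompactSupport hD₁s.mul_right
      · exact (hF₁c.mul (hF₁c.div (hBc.comp hTc)
          fun s => (hB0 _).ne')).integrable_of_hasCompactSupport hF₁s.mul_right
    · filter_upwards [hΨ'.prod_right_ae] with s hs using key s hs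

theorem pairP_le {m : ℕ} (y z : ℝ × EuclideanSpace ℝ (Fin m)) : pairP y z ≤ (2 * ‖y‖) * ‖z‖ := by
  have h1 : y.1 * z.1 ≤ ‖y‖ * ‖z‖ := (le_abs_self _).trans <| by
    rw [abs_mul]; exact mul_le_mul (norm_fst_le y) (norm_fst_le z) (abs_nonneg _) (norm_nonneg _)
  have h2 : ⟪y.2, z.2⟫ ≤ ‖y‖ * ‖z‖ := (real_inner_le_norm _ _).trans
    (mul_le_mul (norm_snd_le y) (norm_snd_le z) (norm_nonneg _) (norm_nonneg _))
  unfold pairP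
  linarith

/-- An even, convex, `q`-homogeneous cost, positive away from the origin. -/
structure IsCost {m : ℕ} (q : ℝ) (C : ℝ × EuclideanSpace ℝ (Fin m) → ℝ) : Prop where
  one_lt : 1 < q
  nonneg : ∀ y, 0 ≤ C y
  even : ∀ y, C (-y) = C y
  convex : ConvexOn ℝ univ C
  hom : ∀ l : ℝ, 0 ≤ l → ∀ y, C (l • y) = l ^ q * C y
  pos : ∀ y, y ≠ 0 → 0 < C y

/-- The integral of `C^{-m}` over the slice `{1} × ℝ^m`. -/
def sliceIntegral {m : ℕ} (C : ℝ × EuclideanSpace ℝ (Fin m) → ℝ) : ℝ :=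
  ∫ x : EuclideanSpace ℝ (Fin m), C (1, x) ^ (-(m : ℝ))

namespace IsCost

variable {m : ℕ} {q : ℝ} {C : ℝ × EuclideanSpace ℝ (Fin m) → ℝ}

theorem q_pos (hC : IsCost q C) : 0 < q := zero_lt_one.trans hC.one_lt

theorem continuous (hC : IsCost q C) : Continuous C := hC.convex.locallyLipschitz.continuous

theorem map_zero (hC : IsCost q C) : C 0 = 0 := by
  simpa [zero_rpow hC.q_pos.ne'] using hC.hom 0 le_rfl 0

theorem pos_of_fst_ne_zero (hC : IsCost q C) {t : ℝ} (ht : t ≠ 0) (x : EuclideanSpace ℝ (Fin m)) :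
    0 < C (t, x) := hC.pos _ fun h => ht (congrArg Prod.fst h)

theorem hom_abs (hC : IsCost q C) (l : ℝ) (y : ℝ × EuclideanSpace ℝ (Fin m)) :
    C (l • y) = |l| ^ q * C y := by
  rcases le_total 0 l with h | h
  · rw [abs_of_nonneg h, hC.hom l h]
  · rw [abs_of_nonpos h, ← hC.hom (-l) (neg_nonneg.2 h), neg_smul, hC.even]

theorem exists_le_norm (hC : IsCost q C) : ∃ c, 0 < c ∧ ∀ y, c * ‖y‖ ^ q ≤ C y := by
  obtain ⟨y₀, hy₀, hmin⟩ := (isCompact_sphere (0 : ℝ × EuclideanSpace ℝ (Fin m)) 1).exists_isMinOn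
    ((NormedSpace.sphere_nonempty (E := ℝ × EuclideanSpace ℝ (Fin m))).2 zero_le_one)
    hC.continuous.continuousOn
  have hy₀' : y₀ ≠ 0 := by
    rintro rfl; simp at hy₀
  refine ⟨C y₀, hC.pos _ hy₀', fun y => ?_⟩
  by_cases hy : y = 0
  · simp [hy, zero_rpow hC.q_pos.ne', hC.map_zero]
  · have h1 : C y₀ ≤ C (‖y‖⁻¹ • y) := hmin (by simp [norm_smul, hy])
    have h2 : C y = ‖y‖ ^ q * C (‖y‖⁻¹ • y) := by
      rw [← hC.hom _ (norm_nonneg y), smul_smul, mul_inv_cancel₀ (norm_ne_zero_iff.2 hy), one_smul]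
    rw [h2, mul_comm]
    gcongr

theorem bddAbove (hC : IsCost q C) (y : ℝ × EuclideanSpace ℝ (Fin m)) :
    BddAbove (range fun z => pairP y z - C z) := by
  obtain ⟨c, hc, hle⟩ := hC.exists_le_norm
  set M := 2 * ‖y‖ with hM
  have hM0 : 0 ≤ M := by positivity
  have hq1 : 0 < q - 1 := sub_pos.2 hC.one_lt
  refine ⟨M * (M / c) ^ (q - 1)⁻¹, ?_⟩
  rintro _ ⟨z, rfl⟩
  have h1 := pairP_le y z
  have h2 := hle z
  have h3 : 0 ≤ M * (M / c) ^ (q - 1)⁻¹ := by positivity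
  change pairP y z - C z ≤ _
  rcases le_or_gt ‖z‖ ((M / c) ^ (q - 1)⁻¹) with h | h
  · have := mul_le_mul_of_nonneg_left h hM0
    have := hC.nonneg z
    linarith
  · have hz : 0 < ‖z‖ := lt_of_le_of_lt (by positivity) h
    have h4 : M / c ≤ ‖z‖ ^ (q - 1) := by
      have := rpow_le_rpow (by positivity) h.le hq1.le
      rwa [← rpow_mul (by positivity), inv_mul_cancel₀ hq1.ne', rpow_one] at this
    have h5 : ‖z‖ ^ q = ‖z‖ ^ (q - 1) * ‖z‖ := by
      rw [← rpow_add_one hz.ne', sub_add_cancel]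
    have h6 : M * ‖z‖ ≤ c * ‖z‖ ^ q := by
      rw [h5, ← mul_assoc]
      gcongr
      rwa [div_le_iff₀' hc] at h4
    linarith

theorem young (hC : IsCost q C) (y z : ℝ × EuclideanSpace ℝ (Fin m)) :
    pairP y z - C z ≤ legendreP C y := le_ciSup (hC.bddAbove y) z

theorem legendreP_nonneg (hC : IsCost q C) (y : ℝ × EuclideanSpace ℝ (Fin m)) :
    0 ≤ legendreP C y := by
  simpa [pairP, hC.map_zero] using hC.young y 0

theorem legendreP_zero (hC : IsCost q C) : legendreP C 0 = 0 :=
  le_antisymm (ciSup_le fun z => by simpa [pairP] using hC.nonneg z) (hC.legendreP_nonneg 0)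

theorem continuous_legendreP (hC : IsCost q C) : Continuous (legendreP C) := by
  refine ConvexOn.locallyLipschitz ⟨convex_univ, fun x _ y _ a b ha hb hab => ?_⟩ |>.continuous
  refine ciSup_le fun z => ?_
  have h1 := mul_le_mul_of_nonneg_left (hC.young x z) ha
  have h2 := mul_le_mul_of_nonneg_left (hC.young y z) hb
  have h3 : pairP (a • x + b • y) z - C z = a * (pairP x z - C z) + b * (pairP y z - C z) := by
    have : C z = a * C z + b * C z := by rw [← add_mul, hab, one_mul]
    simp only [pairP, Prod.fst_add, Prod.smul_fst, Prod.snd_add, Prod.smul_snd, inner_add_left,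
      real_inner_smul_left, smul_eq_mul]
    linarith
  rw [h3]
  simpa using add_le_add h1 h2

theorem integrable_one (hC : IsCost q C) (hm : 0 < m) :
    Integrable fun x : EuclideanSpace ℝ (Fin m) => C (1, x) ^ (-(m : ℝ)) := by
  obtain ⟨c, hc, hle⟩ := hC.exists_le_norm
  have hm' : (0 : ℝ) < m := Nat.cast_pos.2 hm
  have h1 : Integrable fun x : EuclideanSpace ℝ (Fin m) => (1 + ‖x‖) ^ (-(q * m)) :=
    integrable_one_add_norm (by
      rw [finrank_euclideanSpace_fin]; exact lt_mul_of_one_lt_left hm' hC.one_lt)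
  refine (h1.const_mul ((c * 2⁻¹ ^ q) ^ (-(m : ℝ)))).mono' ?_ ?_
  · exact ((hC.continuous.comp (Continuous.prodMk_right 1)).rpow_const fun x =>
      Or.inl (hC.pos_of_fst_ne_zero one_ne_zero x).ne').aestronglyMeasurable
  · refine Filter.Eventually.of_forall fun x => ?_
    have hp := hC.pos_of_fst_ne_zero one_ne_zero x
    rw [norm_of_nonneg (rpow_nonneg hp.le _)]
    have h2 : (1 + ‖x‖) / 2 ≤ ‖((1 : ℝ), x)‖ := by
      have h3 := norm_fst_le ((1 : ℝ), x)
      have h4 := norm_snd_le ((1 : ℝ), x)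
      simp only [norm_one] at h3 h4
      linarith
    have h5 : c * 2⁻¹ ^ q * (1 + ‖x‖) ^ q ≤ C (1, x) := by
      refine le_trans ?_ (hle (1, x))
      rw [mul_assoc, ← mul_rpow (by norm_num) (by positivity)]
      have : 2⁻¹ * (1 + ‖x‖) ≤ ‖((1 : ℝ), x)‖ := by linarith
      have := hC.q_pos
      gcongr
    have hpos : (0 : ℝ) < 1 + ‖x‖ := by positivity
    calc C (1, x) ^ (-(m : ℝ)) ≤ (c * 2⁻¹ ^ q * (1 + ‖x‖) ^ q) ^ (-(m : ℝ)) :=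
          rpow_le_rpow_of_nonpos (by positivity) h5 (by linarith)
      _ = _ := by
        rw [mul_rpow (by positivity) (by positivity), ← rpow_mul hpos.le, mul_neg]

theorem sliceIntegral_pos (hC : IsCost q C) (hm : 0 < m) : 0 < sliceIntegral C := by
  have hpos : ∀ x, 0 < C (1, x) ^ (-(m : ℝ)) := fun x =>
    rpow_pos_of_pos (hC.pos_of_fst_ne_zero one_ne_zero x) _
  rw [sliceIntegral, integral_pos_iff_support_of_nonneg (fun x => (hpos x).le)
    (hC.integrable_one hm), show Function.support _ = univ from
      eq_univ_of_forall fun x => (hpos x).ne']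
  exact Measure.measure_univ_pos.2 (NeZero.ne _)

theorem slice_eq (hC : IsCost q C) {t : ℝ} (ht : 0 < t) (x : EuclideanSpace ℝ (Fin m)) :
    C (t, x) = t ^ q * C (1, t⁻¹ • x) := by
  rw [← hC.hom t ht.le, Prod.smul_mk, smul_smul, mul_inv_cancel₀ ht.ne', one_smul, smul_eq_mul,
    mul_one]

theorem slice_rpow_eq (hC : IsCost q C) {t : ℝ} (ht : 0 < t) (x : EuclideanSpace ℝ (Fin m)) :
    C (t, x) ^ (-(m : ℝ)) = t ^ (-(q * m)) * C (1, t⁻¹ • x) ^ (-(m : ℝ)) := by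
  rw [hC.slice_eq ht, mul_rpow (by positivity) (hC.nonneg _), ← rpow_mul ht.le, mul_neg]

theorem integrable_slice (hC : IsCost q C) (hm : 0 < m) {t : ℝ} (ht : 0 < t) :
    Integrable fun x : EuclideanSpace ℝ (Fin m) => C (t, x) ^ (-(m : ℝ)) := by
  simp_rw [hC.slice_rpow_eq ht]
  exact ((hC.integrable_one hm).comp_smul (inv_ne_zero ht.ne')).const_mul _

theorem integral_slice (hC : IsCost q C) {t : ℝ} (ht : 0 < t) :
    ∫ x : EuclideanSpace ℝ (Fin m), C (t, x) ^ (-(m : ℝ)) =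
      t ^ (-((q - 1) * m)) * sliceIntegral C := by
  simp_rw [hC.slice_rpow_eq ht]
  rw [integral_const_mul,
    Measure.integral_comp_inv_smul_of_nonneg volume (fun x => C (1, x) ^ (-(m : ℝ))) ht.le,
    finrank_euclideanSpace_fin, smul_eq_mul, ← mul_assoc, ← rpow_natCast, ← rpow_add ht]
  congr 2; ring

theorem integral_sublevel (hC : IsCost q C) (hm : 0 < m) :
    ∫ y in {y | C y ≤ 1} ∩ {y : ℝ × EuclideanSpace ℝ (Fin m) | 0 < y.1},
      y.1 ^ (q * m - m - 1) = sliceIntegral C / (q * m) := by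
  have hm' : (0 : ℝ) < m := Nat.cast_pos.2 hm
  have hqm : 0 < q * m := mul_pos hC.q_pos hm'
  set S : Set (ℝ × EuclideanSpace ℝ (Fin m)) := {y | C y ≤ 1} ∩ {y | 0 < y.1} with hS
  have hSm : MeasurableSet S :=
    (measurableSet_le hC.continuous.measurable measurable_const).inter
      (measurableSet_lt measurable_const measurable_fst)
  set h : EuclideanSpace ℝ (Fin m) → ℝ := fun x => C (1, x) ^ (-q⁻¹) with hh
  have hC1 : Continuous fun x : EuclideanSpace ℝ (Fin m) => C (1, x) :=
    hC.continuous.comp (Continuous.prodMk_right 1)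
  have hpos : ∀ x : EuclideanSpace ℝ (Fin m), 0 < C (1, x) :=
    fun x => hC.pos_of_fst_ne_zero one_ne_zero x
  have hhm : Measurable h := hC1.measurable.pow_const _
  have h1 : ∫⁻ x, ENNReal.ofReal (C (1, x) ^ (-(m : ℝ))) =
      ENNReal.ofReal (q * m) * ∫⁻ t in Ioi 0, volume {x | t ≤ h x} *
        ENNReal.ofReal (t ^ (q * m - 1)) := by
    rw [← lintegral_rpow_eq_lintegral_meas_le_mul volume
      (Filter.Eventually.of_forall fun x => rpow_nonneg (hpos x).le _) hhm.aemeasurable hqm]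
    refine lintegral_congr fun x => ?_
    rw [← rpow_mul (hpos x).le, neg_mul, inv_mul_cancel_left₀ hC.q_pos.ne']
  have h2 : ∫⁻ y in S, ENNReal.ofReal (y.1 ^ (q * m - m - 1)) =
      ∫⁻ t in Ioi 0, volume {x | t ≤ h x} * ENNReal.ofReal (t ^ (q * m - 1)) := by
    rw [← lintegral_indicator hSm, Measure.volume_eq_prod, lintegral_prod _ (by
      refine (Measurable.indicator ?_ hSm).aemeasurable
      exact (measurable_fst.pow_const _).ennreal_ofReal), ← lintegral_indicator measurableSet_Ioi]
    refine lintegral_congr fun t => ?_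
    by_cases ht : 0 < t
    · rw [indicator_of_mem (mem_Ioi.2 ht)]
      have hmem : ∀ x, (t, x) ∈ S ↔ x ∈ (fun x => t⁻¹ • x) ⁻¹' {x | t ≤ h x} := fun x => by
        have hx := hpos (t⁻¹ • x)
        have h4 : t ≤ C (1, t⁻¹ • x) ^ (-q⁻¹) ↔ t ^ q * C (1, t⁻¹ • x) ≤ 1 := by
          rw [← rpow_le_rpow_iff ht.le (by positivity) hC.q_pos, ← rpow_mul hx.le, neg_mul,
            inv_mul_cancel₀ hC.q_pos.ne', rpow_neg_one, ← one_div, le_div_iff₀ hx]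
        simp [hS, hh, ht, hC.slice_eq ht, h4]
      have h3 : ∀ x, S.indicator (fun y => ENNReal.ofReal (y.1 ^ (q * m - m - 1))) (t, x) =
          ((fun x => t⁻¹ • x) ⁻¹' {x | t ≤ h x}).indicator
            (fun _ => ENNReal.ofReal (t ^ (q * m - m - 1))) x := fun x => by
        by_cases hx : (t, x) ∈ S
        · rw [indicator_of_mem hx, indicator_of_mem ((hmem x).1 hx)]
        · rw [indicator_of_notMem hx, indicator_of_notMem fun h => hx ((hmem x).2 h)]
      simp_rw [h3]
      rw [lintegral_indicator ((measurable_const_smul t⁻¹)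
          (measurableSet_le measurable_const hhm)), setLIntegral_const,
        Measure.addHaar_preimage_smul _ (inv_ne_zero ht.ne'), finrank_euclideanSpace_fin,
        inv_pow, inv_inv, abs_of_pos (by positivity), ← mul_assoc,
        ← ENNReal.ofReal_mul (by positivity), mul_comm (volume _), ← rpow_natCast, ← rpow_add ht]
      congr 3; ring
    · have h3 : ∀ x, S.indicator (fun y => ENNReal.ofReal (y.1 ^ (q * m - m - 1))) (t, x) = 0 :=
        fun x => indicator_of_notMem (fun h => ht h.2) _
      simp_rw [h3]
      rw [lintegral_zero, indicator_of_notMem (by simpa using ht)]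
  have h5 : ∫ y in S, y.1 ^ (q * m - m - 1) =
      (∫⁻ y in S, ENNReal.ofReal (y.1 ^ (q * m - m - 1))).toReal :=
    integral_eq_lintegral_of_nonneg_ae
      ((ae_restrict_iff' hSm).2 (Filter.Eventually.of_forall fun y hy => rpow_nonneg hy.2.le _))
      (measurable_fst.pow_const _).aestronglyMeasurable
  have h6 : sliceIntegral C = (∫⁻ x, ENNReal.ofReal (C (1, x) ^ (-(m : ℝ)))).toReal :=
    integral_eq_lintegral_of_nonneg_ae
      (Filter.Eventually.of_forall fun x => rpow_nonneg (hpos x).le _)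
      (hC1.measurable.pow_const _).aestronglyMeasurable
  rw [h5, h6, h1, h2, ENNReal.toReal_mul, ENNReal.toReal_ofReal hqm.le,
    mul_div_cancel_left₀ _ hqm.ne']

end IsCost

theorem exists_cube_lt_setIntegral {m : ℕ} {G : (Fin m → ℝ) → ℝ} (hGi : Integrable G) {c : ℝ}
    (hc : c < ∫ z, G z) :
    ∃ R : ℝ, 0 < R ∧ c < ∫ z in Icc (fun _ => -R) (fun _ => R), G z := by
  have hmono : Monotone fun k : ℕ => Icc (fun _ : Fin m => -(k : ℝ)) (fun _ => (k : ℝ)) :=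
    fun a b hab => Icc_subset_Icc (fun _ => by simpa using hab) (fun _ => by simpa using hab)
  have hU : ⋃ k : ℕ, Icc (fun _ : Fin m => -(k : ℝ)) (fun _ => (k : ℝ)) = univ := by
    refine eq_univ_of_forall fun z => mem_iUnion.2 ?_
    obtain ⟨k, hk⟩ := exists_nat_ge ‖z‖
    have h : ∀ i, |z i| ≤ k := fun i => (norm_le_pi_norm z i).trans hk
    exact ⟨k, fun i => (abs_le.1 (h i)).1, fun i => (abs_le.1 (h i)).2⟩
  have ht := tendsto_setIntegral_of_monotone (μ := volume) (f := G) (fun k => measurableSet_Icc) hmono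
    hGi.integrableOn
  rw [hU, setIntegral_univ] at ht
  obtain ⟨k, hk, hk'⟩ := ((ht.eventually_const_lt hc).and (Filter.eventually_gt_atTop 0)).exists
  exact ⟨k, by exact_mod_cast hk', hk⟩

theorem mul_rpow_prod_le_sum {m : ℕ} (hm : 0 < m) {l : Fin m → ℝ} (hl : ∀ i, 0 ≤ l i) :
    (m : ℝ) * (∏ i, l i) ^ (m : ℝ)⁻¹ ≤ ∑ i, l i := by
  have hm' : (0 : ℝ) < m := Nat.cast_pos.2 hm
  have h := geom_mean_le_arith_mean_weighted Finset.univ (fun _ : Fin m => (m : ℝ)⁻¹) l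
    (fun _ _ => by positivity) (by simp [hm'.ne']) fun i _ => hl i
  rw [finsetProd_rpow _ _ fun i _ => hl i, ← Finset.mul_sum, inv_mul_eq_div, le_div_iff₀' hm'] at h
  exact h

/-- Transport of a density `F` to a density `G` of larger mass on Euclidean space, with the trace
of the differential bounded below through the arithmetic-geometric mean inequality. -/
theorem integral_nonneg_of_transport {m : ℕ} (hm : 0 < m) {F G Ψ : EuclideanSpace ℝ (Fin m) → ℝ}
    (hF : ContDiff ℝ 1 F) (hFs : HasCompactSupport F) (hF0 : ∀ x, 0 ≤ F x) (hG : Continuous G)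
    (hG0 : ∀ z, 0 < G z) (hGi : Integrable G) (hFG : ∫ x, F x < ∫ z, G z) (hΨ : Integrable Ψ)
    (hΨ0 : ∀ x, F x = 0 → 0 ≤ Ψ x)
    (hΨF : ∀ x z, 0 < F x →
      -(fderiv ℝ F x z) - F x * (m * (F x / G z) ^ (m : ℝ)⁻¹) ≤ Ψ x) :
    0 ≤ ∫ x, Ψ x := by
  have hm' : (0 : ℝ) < m := Nat.cast_pos.2 hm
  have hFi : Integrable F := hF.continuous.integrable_of_hasCompactSupport hFs
  set T : (Fin m → ℝ) ≃L[ℝ] EuclideanSpace ℝ (Fin m) := (EuclideanSpace.equiv (Fin m) ℝ).symm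
  have hT : MeasurePreserving T := PiLp.volume_preserving_toLp (Fin m)
  have hTe : MeasurableEmbedding T := T.toHomeomorph.measurableEmbedding
  by_cases hF00 : ∫ x, F x = 0
  · have h1 : F = 0 := by
      have := (integral_eq_zero_iff_of_nonneg hF0 hFi).1 hF00
      exact (hF.continuous.ae_eq_iff_eq volume continuous_zero).1 this
    exact integral_nonneg fun x => hΨ0 x (by rw [h1]; rfl)
  have hFpos : 0 < ∫ x, F x := lt_of_le_of_ne (integral_nonneg hF0) (Ne.symm hF00)
  rw [← hT.integral_comp hTe G] at hFG
  obtain ⟨R, hR, hFR⟩ := exists_cube_lt_setIntegral (G := fun z => G (T z))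
    (hT.integrable_comp_of_integrable hGi) hFG
  set I := ∫ z in Icc (fun _ => -R) (fun _ => R), G (T z)
  set θ := (∫ x, F x) / I with hθ
  have hI : 0 < I := hFpos.trans hFR
  have hθ0 : 0 < θ := div_pos hFpos hI
  have hθ1 : θ ≤ 1 := (div_le_one hI).2 hFR.le
  rw [← hT.integral_comp hTe Ψ]
  refine integral_nonneg_of_triangular_transport m hR (F := fun x => F (T x))
    (G := fun z => θ * G (T z)) (Ψ := fun x => Ψ (T x)) (hF.comp T.contDiff)
    (hFs.comp_homeomorph T.toHomeomorph) (fun x => hF0 _) (by fun_prop)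
    (fun z => mul_pos hθ0 (hG0 _)) ?_ (hT.integrable_comp_of_integrable hΨ)
    (fun x => hΨ0 _) ?_
  · rw [integral_const_mul, hT.integral_comp hTe F, hθ, div_mul_cancel₀ _ hI.ne']
  · intro x z l hl hlF
    have hprod : 0 < ∏ i, l i := Finset.prod_pos fun i _ => hl i
    have hFx : 0 < F (T x) := by
      rw [← hlF]; exact mul_pos (mul_pos hθ0 (hG0 _)) hprod
    have hd : fderiv ℝ (fun x => F (T x)) x z = fderiv ℝ F (T x) (T z) := by
      have := ((hF.differentiable one_ne_zero (T x)).hasFDerivAt.comp x T.hasFDerivAt).fderiv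
      rw [show (fun x => F (T x)) = F ∘ T from rfl, this]; rfl
    rw [hd]
    refine le_trans ?_ (hΨF (T x) (T z) hFx)
    have h1 : F (T x) / G (T z) ≤ ∏ i, l i := by
      rw [div_le_iff₀ (hG0 _), ← hlF]
      nlinarith [mul_pos (hG0 (T z)) hprod]
    have h2 := mul_rpow_prod_le_sum hm fun i => (hl i).le
    have h3 : (F (T x) / G (T z)) ^ (m : ℝ)⁻¹ ≤ (∏ i, l i) ^ (m : ℝ)⁻¹ :=
      rpow_le_rpow (div_nonneg hFx.le (hG0 _).le) h1 (by positivity)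
    have h4 : (m : ℝ) * (F (T x) / G (T z)) ^ (m : ℝ)⁻¹ ≤ ∑ i, l i :=
      (mul_le_mul_of_nonneg_left h3 hm'.le).trans h2
    have := mul_le_mul_of_nonneg_left h4 hFx.le
    linarith

/-- The full gradient of a function on `ℝ × ℝ^m`. -/
def gradP {m : ℕ} (f : ℝ × EuclideanSpace ℝ (Fin m) → ℝ) (y : ℝ × EuclideanSpace ℝ (Fin m)) :
    ℝ × EuclideanSpace ℝ (Fin m) :=
  (fderiv ℝ f y (1, 0), gradient (fun x => f (y.1, x)) y.2)

theorem gradP_eq {m : ℕ} {f : ℝ × EuclideanSpace ℝ (Fin m) → ℝ}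
    {y : ℝ × EuclideanSpace ℝ (Fin m)} {D : ℝ × EuclideanSpace ℝ (Fin m) →L[ℝ] ℝ}
    (hf : HasFDerivAt f D y) :
    gradP f y = (D (1, 0), (InnerProductSpace.toDual ℝ (EuclideanSpace ℝ (Fin m))).symm
      (D.comp (ContinuousLinearMap.inr ℝ ℝ (EuclideanSpace ℝ (Fin m))))) := by
  have h : HasFDerivAt (fun x => f (y.1, x))
      (D.comp (ContinuousLinearMap.inr ℝ ℝ (EuclideanSpace ℝ (Fin m)))) y.2 :=
    HasFDerivAt.comp (f := fun x => (y.1, x)) (g := f) y.2 hf (hasFDerivAt_prodMk_right y.1 y.2)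
  rw [gradP, gradient, h.fderiv, hf.fderiv]

theorem pairP_gradP {m : ℕ} {f : ℝ × EuclideanSpace ℝ (Fin m) → ℝ}
    {y : ℝ × EuclideanSpace ℝ (Fin m)} {D : ℝ × EuclideanSpace ℝ (Fin m) →L[ℝ] ℝ}
    (hf : HasFDerivAt f D y) (v : ℝ × EuclideanSpace ℝ (Fin m)) :
    pairP (gradP f y) v = D v := by
  rw [gradP_eq hf, pairP, InnerProductSpace.toDual_symm_apply]
  have hv : v = v.1 • ((1 : ℝ), (0 : EuclideanSpace ℝ (Fin m))) + (0, v.2) := by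
    ext <;> simp
  conv_rhs => rw [hv, map_add, map_smul]
  simp [mul_comm]

theorem continuous_gradP {m : ℕ} {f : ℝ × EuclideanSpace ℝ (Fin m) → ℝ} (hf : ContDiff ℝ 1 f) :
    Continuous (gradP f) := by
  have h : gradP f = fun y => _ :=
    funext fun y => gradP_eq (hf.differentiable one_ne_zero y).hasFDerivAt
  have hD := hf.continuous_fderiv one_ne_zero
  rw [h]
  exact (hD.clm_apply continuous_const).prodMk
    ((InnerProductSpace.toDual ℝ (EuclideanSpace ℝ (Fin m))).symm.continuous.comp
      (hD.clm_comp continuous_const))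

theorem hasCompactSupport_gradP {m : ℕ} {f : ℝ × EuclideanSpace ℝ (Fin m) → ℝ}
    (hf : ContDiff ℝ 1 f) (hfs : HasCompactSupport f) : HasCompactSupport (gradP f) := by
  refine (hfs.fderiv ℝ).mono fun y hy => ?_
  contrapose hy
  simp only [Function.mem_support, not_not] at hy ⊢
  rw [gradP_eq (hf.differentiable one_ne_zero y).hasFDerivAt, hy]
  simp

theorem IsCost.continuous_legendreP_gradP {m : ℕ} {q : ℝ} {C f : ℝ × EuclideanSpace ℝ (Fin m) → ℝ}
    (hC : IsCost q C) (hf : ContDiff ℝ 1 f) : Continuous fun y => legendreP C (gradP f y) :=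
  hC.continuous_legendreP.comp (continuous_gradP hf)

theorem IsCost.hasCompactSupport_legendreP_gradP {m : ℕ} {q : ℝ}
    {C f : ℝ × EuclideanSpace ℝ (Fin m) → ℝ} (hC : IsCost q C) (hf : ContDiff ℝ 1 f)
    (hfs : HasCompactSupport f) : HasCompactSupport fun y => legendreP C (gradP f y) :=
  (hasCompactSupport_gradP hf hfs).comp_left hC.legendreP_zero

/-- The multiplier which saturates the pointwise Young inequality. -/
theorem abs_young_multiplier {m p r : ℝ} (hm : 0 < m) (hp : 1 < p) (hpm : p < m + 1)
    (hr : r = p * m / (m + 1 - p)) {u : ℝ} (hu : u ≠ 0) :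
    |((m + 1 - p) / p) ^ p / m * (r * |u| ^ (r - 2) * u)| ^ (p / (p - 1)) =
      ((m + 1 - p) / p) ^ p * (|u| ^ r * (|u| ^ r) ^ m⁻¹) := by
  have hp0 : 0 < p := by linarith
  have hp1 : 0 < p - 1 := by linarith
  have hN : 0 < m + 1 - p := by linarith
  set a := (m + 1 - p) / p with ha
  have ha0 : 0 < a := div_pos hN hp0
  have har : r = m / a := by rw [hr, ha]; field_simp
  have hr0 : 0 < r := by rw [har]; positivity
  have hu0 : 0 < |u| := abs_pos.2 hu
  have h1 : |a ^ p / m * (r * |u| ^ (r - 2) * u)| = a ^ (p - 1) * |u| ^ (r - 1) := by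
    rw [abs_mul, abs_mul, abs_of_pos (by positivity : 0 < a ^ p / m),
      abs_of_pos (by positivity : 0 < r * |u| ^ (r - 2)), mul_assoc r, ← rpow_add_one hu0.ne',
      show r - 2 + 1 = r - 1 by ring, ← mul_assoc]
    congr 1
    rw [har, rpow_sub_one ha0.ne']
    field_simp
  rw [h1, mul_rpow (by positivity) (by positivity), ← rpow_mul ha0.le, ← rpow_mul hu0.le,
    ← rpow_mul hu0.le, ← rpow_add hu0, mul_div_cancel₀ _ hp1.ne']
  congr 2
  rw [har, ha]
  field_simp
  ring

/-- The slice inequality: a lower bound of the energy on a slice through the derivative of the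
mass of the slices. -/
theorem IsCost.slice_inequality {m : ℕ} {p r : ℝ} {C f : ℝ × EuclideanSpace ℝ (Fin m) → ℝ}
    (hm : 0 < m) (hp : 1 < p) (hpm : p < m + 1) (hC : IsCost (p / (p - 1)) C)
    (hr : r = p * m / (m + 1 - p)) (hf : ContDiff ℝ 1 f) (hfs : HasCompactSupport f) {c t : ℝ}
    (hc : 0 < c) (hA : ∫ x, |f (t, x)| ^ r < ∫ x, C (c, x) ^ (-(m : ℝ))) :
    -(((m + 1 - p) / p) ^ p / m * c * ∫ x, fderiv ℝ (fun y => |f y| ^ r) (t, x) (1, 0)) ≤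
      ∫ x, legendreP C (gradP f (t, x)) := by
  have hm' : (0 : ℝ) < m := Nat.cast_pos.2 hm
  have hp0 : 0 < p := by linarith
  have hN : 0 < m + 1 - p := by linarith
  have hr1 : 1 < r := by
    rw [hr, lt_div_iff₀ hN]; nlinarith
  have hr0 : 0 < r := by linarith
  set k := ((m + 1 - p) / p) ^ p / m with hk
  have hk0 : 0 < k := by positivity
  set F : ℝ × EuclideanSpace ℝ (Fin m) → ℝ := fun y => |f y| ^ r with hFdef
  have hF : ContDiff ℝ 1 F := hf.norm_rpow hr1
  have hFs : HasCompactSupport F := hfs.comp_left (g := fun s : ℝ => |s| ^ r)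
    (by simp [zero_rpow hr0.ne'])
  have hFd : ∀ y, HasFDerivAt F ((r * |f y| ^ (r - 2) * f y) • fderiv ℝ f y) y := fun y =>
    (hasDerivAt_abs_rpow (f y) hr1).comp_hasFDerivAt y
      (hf.differentiable one_ne_zero y).hasFDerivAt
  have hD : Continuous fun y => fderiv ℝ F y (1, 0) :=
    (hF.continuous_fderiv one_ne_zero).clm_apply continuous_const
  have hDs : HasCompactSupport fun y => fderiv ℝ F y (1, 0) := hFs.fderiv_apply ℝ _
  have hslice : ∀ {g : ℝ × EuclideanSpace ℝ (Fin m) → ℝ}, Continuous g → HasCompactSupport g →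
      Integrable fun x => g (t, x) := fun hg hgs =>
    (hg.comp (Continuous.prodMk_right t)).integrable_of_hasCompactSupport
      (hasCompactSupport_slice hgs t)
  have hPi := hslice (hC.continuous_legendreP_gradP hf) (hC.hasCompactSupport_legendreP_gradP hf hfs)
  have hDi := hslice hD hDs
  have hCpos : ∀ x, 0 < C (c, x) := fun x => hC.pos_of_fst_ne_zero hc.ne' x
  have key := integral_nonneg_of_transport hm (F := fun x => F (t, x))
    (G := fun x => C (c, x) ^ (-(m : ℝ)))
    (Ψ := fun x => k⁻¹ * legendreP C (gradP f (t, x)) + c * fderiv ℝ F (t, x) (1, 0))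
    (hF.comp (contDiff_prodMk_right t)) (hasCompactSupport_slice hFs t)
    (fun x => rpow_nonneg (abs_nonneg _) _)
    ((hC.continuous.comp (Continuous.prodMk_right c)).rpow_const fun x => Or.inl (hCpos x).ne')
    (fun x => rpow_pos_of_pos (hCpos x) _) (hC.integrable_slice hm hc) hA
    ((hPi.const_mul _).add (hDi.const_mul _)) (fun x hx => ?_) (fun x z hx => ?_)
  · rw [integral_add (hPi.const_mul _) (hDi.const_mul _), integral_const_mul,
      integral_const_mul] at key
    have := mul_nonneg hk0.le key
    rw [mul_add, mul_inv_cancel_left₀ hk0.ne'] at this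
    linarith
  · rw [fderiv_eq_zero_of_nonneg_of_eq_zero (fun y => rpow_nonneg (abs_nonneg _) _) hx]
    have := hC.legendreP_nonneg (gradP f (t, x))
    simpa using mul_nonneg (inv_nonneg.2 hk0.le) this
  · set u := f (t, x) with hu
    have hu0 : u ≠ 0 := by
      rintro h
      simp [hFdef, ← hu, h, zero_rpow hr0.ne'] at hx
    have hsl : fderiv ℝ (fun x => F (t, x)) x z = r * |u| ^ (r - 2) * u * fderiv ℝ f (t, x) (0, z) := by
      have := (HasFDerivAt.comp (f := fun x => (t, x)) (g := F) x (hFd (t, x))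
        (hasFDerivAt_prodMk_right t x)).fderiv
      rw [show (fun x => F (t, x)) = F ∘ fun x => (t, x) from rfl, this]
      rfl
    have hM := abs_young_multiplier hm' hp hpm hr hu0
    rw [← hk] at hM
    set g := r * |u| ^ (r - 2) * u with hg
    have hy := hC.young (gradP f (t, x)) (-(k * g) • (c, z))
    rw [pairP_gradP (hf.differentiable one_ne_zero (t, x)).hasFDerivAt, hC.hom_abs, abs_neg, hM,
      map_smul, smul_eq_mul] at hy
    have hcz : fderiv ℝ f (t, x) (c, z) = c * fderiv ℝ f (t, x) (1, 0) + fderiv ℝ f (t, x) (0, z) := by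
      rw [← smul_eq_mul, ← map_smul, ← map_add]; simp
    rw [hsl, (hFd (t, x)).fderiv, ← hu, ← hg]
    change -(g * fderiv ℝ f (t, x) (0, z)) -
      |u| ^ r * (m * (|u| ^ r / C (c, z) ^ (-(m : ℝ))) ^ (m : ℝ)⁻¹) ≤
      k⁻¹ * legendreP C (gradP f (t, x)) + c * (g * fderiv ℝ f (t, x) (1, 0))
    have hCz : (|u| ^ r / C (c, z) ^ (-(m : ℝ))) ^ (m : ℝ)⁻¹ = (|u| ^ r) ^ (m : ℝ)⁻¹ * C (c, z) := by
      rw [rpow_neg (hCpos z).le, div_inv_eq_mul, mul_rpow (by positivity)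
        (by have := hCpos z; positivity), ← rpow_mul (hCpos z).le, mul_inv_cancel₀ hm'.ne', rpow_one]
    have hka : ((m + 1 - p) / p) ^ p = k * m := by rw [hk, div_mul_cancel₀ _ hm'.ne']
    rw [hCz]
    rw [hcz, hka] at hy
    rw [← sub_le_iff_le_add, inv_mul_eq_div, le_div_iff₀' hk0]
    refine le_trans (le_of_eq ?_) hy
    ring

theorem setIntegral_halfSpace {X : Type*} [MeasureSpace X] [SFinite (volume : Measure X)]
    {g : ℝ × X → ℝ} (hg : IntegrableOn g {y | 0 < y.1}) :
    ∫ y in {y : ℝ × X | 0 < y.1}, g y = ∫ t in Ioi 0, ∫ x, g (t, x) := by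
  have hS : {y : ℝ × X | 0 < y.1} = Ioi 0 ×ˢ univ := by ext; simp
  rw [hS] at hg ⊢
  simpa [Measure.volume_eq_prod] using setIntegral_prod (μ := volume) (ν := volume) g hg

theorem IsCost.trace_inequality_of_pos {m : ℕ} {p r : ℝ} {C f : ℝ × EuclideanSpace ℝ (Fin m) → ℝ}
    (hm : 0 < m) (hp : 1 < p) (hpm : p < m + 1) (hC : IsCost (p / (p - 1)) C)
    (hr : r = p * m / (m + 1 - p)) (hf : ContDiff ℝ 1 f) (hfs : HasCompactSupport f) {ε : ℝ}
    (hε : 0 < ε) :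
    ((m + 1 - p) / p) ^ p / (m + 1 - p) * sliceIntegral C ^ ((p - 1) / m) *
        (((∫ x, |f (0, x)| ^ r) + ε) ^ ((m + 1 - p) / m) - ε ^ ((m + 1 - p) / m)) ≤
      ∫ y in {y | 0 < y.1}, legendreP C (gradP f y) := by
  have hm' : (0 : ℝ) < m := Nat.cast_pos.2 hm
  have hp0 : 0 < p := by linarith
  have hp1 : 0 < p - 1 := by linarith
  have hN : 0 < m + 1 - p := by linarith
  have hr1 : 1 < r := by
    rw [hr, lt_div_iff₀ hN]; nlinarith
  have hr0 : 0 < r := by linarith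
  set F : ℝ × EuclideanSpace ℝ (Fin m) → ℝ := fun y => |f y| ^ r with hFdef
  have hF : ContDiff ℝ 1 F := hf.norm_rpow hr1
  have hFs : HasCompactSupport F := hfs.comp_left (g := fun s : ℝ => |s| ^ r)
    (by simp [zero_rpow hr0.ne'])
  have hD : Continuous fun y => fderiv ℝ F y (1, 0) :=
    (hF.continuous_fderiv one_ne_zero).clm_apply continuous_const
  have hDs : HasCompactSupport fun y => fderiv ℝ F y (1, 0) := hFs.fderiv_apply ℝ _
  set M : ℝ → ℝ := fun t => ∫ x, F (t, x) with hM
  set M' : ℝ → ℝ := fun t => ∫ x, fderiv ℝ F (t, x) (1, 0) with hM'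
  have hMd : ∀ t, HasDerivAt M (M' t) t := hasDerivAt_integral_slice hF hFs
  have hM0 : ∀ t, 0 ≤ M t := fun t => integral_nonneg fun x => rpow_nonneg (abs_nonneg _) _
  have hMc : Continuous M := continuous_integral_slice hF.continuous hFs
  have hMs : HasCompactSupport M := hasCompactSupport_integral_slice hFs
  have hM'c : Continuous M' := continuous_integral_slice hD hDs
  have hM's : HasCompactSupport M' := hasCompactSupport_integral_slice hDs
  have hPc := hC.continuous_legendreP_gradP hf
  have hPs := hC.hasCompactSupport_legendreP_gradP hf hfs
  have hPi := hPc.integrable_of_hasCompactSupport hPs (μ := volume)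
  set B := sliceIntegral C with hB
  have hB0 : 0 < B := hC.sliceIntegral_pos hm
  have hMε : ∀ t, 0 < M t + ε := fun t => by linarith [hM0 t]
  set h' : ℝ → ℝ := fun t => M' t * ((m + 1 - p) / m) * (M t + ε) ^ ((m + 1 - p) / m - 1) with hh'
  have hd : ∀ t, HasDerivAt (fun t => (M t + ε) ^ ((m + 1 - p) / m)) (h' t) t := fun t =>
    ((hMd t).add_const ε).rpow_const (Or.inl (hMε t).ne')
  have hh'c : Continuous h' := (hM'c.mul continuous_const).mul
    ((hMc.add continuous_const).rpow_const fun t => Or.inl (hMε t).ne')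
  have hh's : HasCompactSupport h' := hM's.mul_right.mul_right
  have hint : ∫ t in Ioi (0 : ℝ), h' t = ε ^ ((m + 1 - p) / m) - (M 0 + ε) ^ ((m + 1 - p) / m) := by
    refine integral_Ioi_of_hasDerivAt_of_tendsto' (fun t _ => hd t)
      (hh'c.integrable_of_hasCompactSupport hh's).integrableOn ?_
    refine (Filter.EventuallyEq.tendsto ?_).mono_left atTop_le_cocompact
    filter_upwards [hMs.isCompact.compl_mem_cocompact] with t ht
    rw [image_eq_zero_of_notMem_tsupport ht, zero_add]
  set k := ((m + 1 - p) / p) ^ p / (m + 1 - p) * B ^ ((p - 1) / m) with hk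
  rw [setIntegral_halfSpace hPi.integrableOn]
  have hle : ∫ t in Ioi (0 : ℝ), -(k * h' t) ≤
      ∫ t in Ioi (0 : ℝ), ∫ x, legendreP C (gradP f (t, x)) := by
    have hi : Integrable fun t => -(k * h' t) :=
      ((hh'c.integrable_of_hasCompactSupport hh's).const_mul k).neg
    have hJs := hasCompactSupport_integral_slice (μ := volume) hPs
    have hJ : Integrable fun t => ∫ x, legendreP C (gradP f (t, x)) :=
      (continuous_integral_slice hPc hPs).integrable_of_hasCompactSupport hJs
    refine setIntegral_mono hi.integrableOn hJ.integrableOn fun t => ?_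
    have hBM : 0 < B / (M t + ε) := div_pos hB0 (hMε t)
    have hc : 0 < (B / (M t + ε)) ^ ((p - 1) / m) := by positivity
    refine le_trans (le_of_eq ?_) (hC.slice_inequality hm hp hpm hr hf hfs hc (t := t) ?_)
    · change -(k * h' t) = -(((m + 1 - p) / p) ^ p / m * (B / (M t + ε)) ^ ((p - 1) / m) * M' t)
      simp only [hh', hk]
      rw [div_rpow hB0.le (hMε t).le,
        show (m + 1 - p) / m - 1 = -((p - 1) / m) by field_simp; ring, rpow_neg (hMε t).le]
      field_simp
    · rw [hC.integral_slice hc, ← rpow_mul hBM.le,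
        show (p - 1) / m * -((p / (p - 1) - 1) * m) = -1 by field_simp; ring, rpow_neg_one,
        inv_div, div_mul_cancel₀ _ hB0.ne']
      exact lt_add_of_pos_right _ hε
  refine le_trans (le_of_eq ?_) hle
  rw [integral_neg, integral_const_mul, hint]
  ring

/-- The sharp trace inequality, with the constant expressed through the slice integral. -/
theorem IsCost.trace_inequality {m : ℕ} {p r : ℝ} {C f : ℝ × EuclideanSpace ℝ (Fin m) → ℝ}
    (hm : 0 < m) (hp : 1 < p) (hpm : p < m + 1) (hC : IsCost (p / (p - 1)) C)
    (hr : r = p * m / (m + 1 - p)) (hf : ContDiff ℝ 1 f) (hfs : HasCompactSupport f) :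
    ((m + 1 - p) / p) ^ p / (m + 1 - p) * sliceIntegral C ^ ((p - 1) / m) *
        (∫ x, |f (0, x)| ^ r) ^ ((m + 1 - p) / m) ≤
      ∫ y in {y | 0 < y.1}, legendreP C (gradP f y) := by
  have hm' : (0 : ℝ) < m := Nat.cast_pos.2 hm
  have hs : 0 < (m + 1 - p) / m := div_pos (by linarith) hm'
  set k := ((m + 1 - p) / p) ^ p / (m + 1 - p) * sliceIntegral C ^ ((p - 1) / m)
  set M := ∫ x, |f (0, x)| ^ r
  have hcont : Continuous fun ε : ℝ => k * ((M + ε) ^ ((m + 1 - p) / m) - ε ^ ((m + 1 - p) / m)) :=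
    continuous_const.mul (((continuous_const.add continuous_id).rpow_const fun _ => Or.inr hs.le).sub
      (continuous_id.rpow_const fun _ => Or.inr hs.le))
  have ht := (hcont.tendsto 0).mono_left (nhdsWithin_le_nhds (s := Ioi 0))
  rw [add_zero, zero_rpow hs.ne', sub_zero] at ht
  refine le_of_tendsto ht ?_
  filter_upwards [self_mem_nhdsWithin] with ε hε
  exact hC.trace_inequality_of_pos hm hp hpm hr hf hfs hε

theorem LocallyLipschitz.ae_differentiableAt {X : Type*} [NormedAddCommGroup X] [NormedSpace ℝ X]
    [FiniteDimensional ℝ X] [MeasurableSpace X] [BorelSpace X] {μ : Measure X} [μ.IsAddHaarMeasure]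
    {f : X → ℝ} (hf : LocallyLipschitz f) : ∀ᵐ x ∂μ, DifferentiableAt ℝ f x := by
  have := FiniteDimensional.proper_real X
  refine measure_null_of_locally_null _ fun x _ => ?_
  obtain ⟨K, U, hU, hK⟩ := hf x
  refine ⟨interior U ∩ {x | ¬DifferentiableAt ℝ f x},
    Filter.inter_mem (mem_nhdsWithin_of_mem_nhds (interior_mem_nhds.2 hU)) self_mem_nhdsWithin, ?_⟩
  refine measure_mono_null (fun y hy => ?_)
    (ae_iff.1 ((hK.mono interior_subset).ae_differentiableWithinAt_of_mem (μ := μ)))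
  exact fun h => hy.2 ((h hy.1).differentiableAt (isOpen_interior.mem_nhds hy.1))

theorem ConvexOn.add_fderiv_le {X : Type*} [NormedAddCommGroup X] [NormedSpace ℝ X] {f : X → ℝ}
    (hf : ConvexOn ℝ univ f) {x : X} {D : X →L[ℝ] ℝ} (hD : HasFDerivAt f D x) (y : X) :
    f x + D (y - x) ≤ f y := by
  have h := (hD.hasLineDerivAt (y - x)).tendsto_slope_zero_right
  suffices D (y - x) ≤ f y - f x by linarith
  refine le_of_tendsto h ?_
  filter_upwards [Ioc_mem_nhdsGT zero_lt_one] with t ht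
  have h1 := hf.2 (mem_univ x) (mem_univ y) (sub_nonneg.2 ht.2) ht.1.le (sub_add_cancel 1 t)
  have h2 : (1 - t) • x + t • y = x + t • (y - x) := by module
  rw [h2, smul_eq_mul, smul_eq_mul] at h1
  rw [smul_eq_mul, inv_mul_le_iff₀ ht.1]
  linarith

namespace IsCost

variable {m : ℕ} {q : ℝ} {C : ℝ × EuclideanSpace ℝ (Fin m) → ℝ}

theorem ae_differentiableAt (hC : IsCost q C) (v : ℝ × EuclideanSpace ℝ (Fin m)) :
    ∀ᵐ y, DifferentiableAt ℝ C (y + v) := by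
  have : (volume : Measure (ℝ × EuclideanSpace ℝ (Fin m))).IsAddHaarMeasure :=
    inferInstanceAs ((volume : Measure ℝ).prod volume).IsAddHaarMeasure
  exact (measurePreserving_add_right volume v).quasiMeasurePreserving.ae
    (LocallyLipschitz.ae_differentiableAt hC.convex.locallyLipschitz)

/-- Euler's identity. -/
theorem fderiv_self (hC : IsCost q C) {y : ℝ × EuclideanSpace ℝ (Fin m)}
    {D : ℝ × EuclideanSpace ℝ (Fin m) →L[ℝ] ℝ} (hD : HasFDerivAt C D y) : D y = q * C y := by
  have h1 : HasDerivAt (fun l : ℝ => C (l • y)) (D y) 1 := by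
    have hs : HasDerivAt (fun l : ℝ => l • y) ((1 : ℝ) • y) 1 := (hasDerivAt_id 1).smul_const y
    rw [one_smul] at hs
    exact HasFDerivAt.comp_hasDerivAt (f := fun l : ℝ => l • y) 1 (by rwa [one_smul]) hs
  have h2 : HasDerivAt (fun l : ℝ => C (l • y)) (q * C y) 1 := by
    have hp := ((hasDerivAt_id (1 : ℝ)).rpow_const (p := q) (Or.inl one_ne_zero)).mul_const (C y)
    have he : (fun l : ℝ => C (l • y)) =ᶠ[nhds 1] fun l => id l ^ q * C y := by
      filter_upwards [lt_mem_nhds zero_lt_one] with l hl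
      exact hC.hom l hl.le y
    simpa using hp.congr_of_eventuallyEq he
  exact h1.unique h2

/-- The Legendre transform at a multiple of the gradient of the cost. -/
theorem legendreP_eq {p : ℝ} (hp : 1 < p) (hC : IsCost (p / (p - 1)) C)
    {y G : ℝ × EuclideanSpace ℝ (Fin m)} {D : ℝ × EuclideanSpace ℝ (Fin m) →L[ℝ] ℝ}
    (hD : HasFDerivAt C D y) {μ : ℝ} (hG : ∀ z, pairP G z = μ * D z) :
    legendreP C G = |μ| ^ p * C y / (p - 1) := by
  have hp0 : 0 < p := by linarith
  have hp1 : 0 < p - 1 := by linarith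
  have hE := hC.fderiv_self hD
  by_cases hμ : μ = 0
  · subst hμ
    rw [abs_zero, zero_rpow hp0.ne', zero_mul, zero_div]
    exact le_antisymm (ciSup_le fun z => by simpa [hG] using hC.nonneg z) (hC.legendreP_nonneg G)
  have hμ0 : 0 < |μ| := abs_pos.2 hμ
  set s := |μ| ^ (p - 2) * μ with hs
  have hs0 : s ≠ 0 := mul_ne_zero (by positivity) hμ
  have hsa : |s| ^ (p / (p - 1)) = |μ| ^ p := by
    rw [hs, abs_mul, abs_of_nonneg (rpow_nonneg hμ0.le _), ← rpow_add_one hμ0.ne', ← rpow_mul hμ0.le]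
    congr 1
    field_simp
    ring
  have hμs : μ * s = |μ| ^ p := by
    have h2 : μ * s = |μ| ^ (p - 2) * |μ| ^ 2 := by rw [hs, sq_abs]; ring
    rw [h2, ← rpow_natCast, ← rpow_add hμ0]
    congr 1
    norm_num
  have hval : ∀ z, pairP G (s • z) - C (s • z) = |μ| ^ p * (D z - C z) := fun z => by
    rw [hG, hC.hom_abs, hsa, map_smul, smul_eq_mul, ← mul_assoc, hμs, mul_sub]
  have hmax : |μ| ^ p * (D y - C y) = |μ| ^ p * C y / (p - 1) := by
    rw [hE]
    field_simp
    ring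
  refine le_antisymm (ciSup_le fun z => ?_) ?_
  · have hz := hval (s⁻¹ • z)
    rw [smul_smul, mul_inv_cancel₀ hs0, one_smul] at hz
    rw [hz, ← hmax]
    have := ConvexOn.add_fderiv_le hC.convex hD (s⁻¹ • z)
    rw [map_sub] at this
    refine mul_le_mul_of_nonneg_left ?_ (by positivity)
    linarith
  · rw [← hmax, ← hval]
    exact hC.young _ _

/-- The energy density of the extremal functions. -/
theorem legendreP_gradP_extremal {p γ : ℝ} {f : ℝ × EuclideanSpace ℝ (Fin m) → ℝ} (hp : 1 < p)
    (hpm : p < m + 1) (hC : IsCost (p / (p - 1)) C) {v y : ℝ × EuclideanSpace ℝ (Fin m)}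
    (hf : ∀ y, f y = γ * C (y + v) ^ (-((m + 1 - p) / p)))
    (hd : DifferentiableAt ℝ C (y + v)) (hy : 0 < C (y + v)) :
    legendreP C (gradP f y) =
      |γ| ^ p * ((m + 1 - p) / p) ^ p / (p - 1) * C (y + v) ^ (-(m : ℝ)) := by
  have hp0 : 0 < p := by linarith
  have hN : 0 < m + 1 - p := by linarith
  set a := (m + 1 - p) / p with ha
  have ha0 : 0 < a := div_pos hN hp0
  have hDf : HasFDerivAt f (γ • ((-a * C (y + v) ^ (-a - 1)) • fderiv ℝ C (y + v))) y := by
    rw [show f = fun y => γ * C (y + v) ^ (-a) from funext hf]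
    exact (((hasFDerivAt_comp_add_right v).2 hd.hasFDerivAt).rpow_const
      (Or.inl hy.ne')).const_mul γ
  rw [legendreP_eq hp hC hd.hasFDerivAt (μ := γ * (-a * C (y + v) ^ (-a - 1))) fun z => by
    rw [pairP_gradP hDf]; simp [mul_assoc]]
  rw [abs_mul, abs_mul, abs_neg, abs_of_pos ha0, abs_of_nonneg (rpow_nonneg hy.le _),
    mul_rpow (abs_nonneg _) (by positivity), mul_rpow ha0.le (by positivity), ← rpow_mul hy.le]
  have h1 : C (y + v) ^ ((-a - 1) * p) * C (y + v) = C (y + v) ^ (-(m : ℝ)) := by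
    rw [← rpow_add_one hy.ne']
    congr 1
    rw [ha]
    field_simp
    ring
  rw [← h1]
  ring

theorem integral_slice_translate (hC : IsCost q C) {t : ℝ} (ht : 0 < t)
    (x₀ : EuclideanSpace ℝ (Fin m)) :
    ∫ x, C (t, x - x₀) ^ (-(m : ℝ)) = t ^ (-((q - 1) * m)) * sliceIntegral C := by
  rw [integral_sub_right_eq_self (fun x => C (t, x) ^ (-(m : ℝ))), hC.integral_slice ht]

theorem integral_halfSpace_translate (hC : IsCost q C) (hm : 0 < m) (hqm : 1 < (q - 1) * m) {δ : ℝ}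
    (hδ : 0 < δ) (x₀ : EuclideanSpace ℝ (Fin m)) :
    ∫ y in {y : ℝ × EuclideanSpace ℝ (Fin m) | 0 < y.1}, C (y + (δ, -x₀)) ^ (-(m : ℝ)) =
      δ ^ (1 - (q - 1) * m) / ((q - 1) * m - 1) * sliceIntegral C := by
  have hs : -((q - 1) * m) < -1 := by linarith
  have hslice : ∀ t ∈ Ioi (0 : ℝ), ∫ x, C ((t, x) + (δ, -x₀)) ^ (-(m : ℝ)) =
      (t + δ) ^ (-((q - 1) * m)) * sliceIntegral C := fun t ht => by
    simpa [sub_eq_add_neg] using hC.integral_slice_translate (add_pos ht hδ) x₀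
  have hshift : ∫ t in Ioi (0 : ℝ), (t + δ) ^ (-((q - 1) * m)) =
      δ ^ (1 - (q - 1) * m) / ((q - 1) * m - 1) := by
    have h := (measurePreserving_add_right volume δ).setIntegral_preimage_emb
      (measurableEmbedding_addRight δ) (fun t : ℝ => t ^ (-((q - 1) * m))) (Ioi δ)
    rw [preimage_add_const_Ioi, sub_self] at h
    rw [h, integral_Ioi_rpow_of_lt hs hδ, ← neg_div_neg_eq]
    congr 1
    · rw [neg_neg]; congr 1; ring
    · ring
  have hint : IntegrableOn (fun y => C (y + (δ, -x₀)) ^ (-(m : ℝ)))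
      {y : ℝ × EuclideanSpace ℝ (Fin m) | 0 < y.1} := by
    have hS : {y : ℝ × EuclideanSpace ℝ (Fin m) | 0 < y.1} = Ioi 0 ×ˢ univ := by ext; simp
    rw [hS, IntegrableOn, Measure.volume_eq_prod, ← Measure.prod_restrict, Measure.restrict_univ,
      integrable_prod_iff]
    · refine ⟨(ae_restrict_iff' measurableSet_Ioi).2 (Filter.Eventually.of_forall fun t ht => ?_), ?_⟩
      · simpa [sub_eq_add_neg] using
          (hC.integrable_slice hm (add_pos (mem_Ioi.1 ht) hδ)).comp_sub_right x₀
      · refine IntegrableOn.congr_fun ((integrableOn_add_rpow_Ioi_of_lt hs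
          (neg_lt_zero.2 hδ)).mul_const (sliceIntegral C)) (fun t ht => ?_) measurableSet_Ioi
        rw [← hslice t ht]
        exact integral_congr_ae (Filter.Eventually.of_forall fun x =>
          (norm_of_nonneg (rpow_nonneg (hC.nonneg _) _)).symm)
    · exact ((hC.continuous.measurable.comp (measurable_add_const _)).pow_const _).aestronglyMeasurable
  rw [setIntegral_halfSpace hint, setIntegral_congr_fun measurableSet_Ioi hslice, integral_mul_const,
    hshift]

/-- Equality in the trace inequality for the extremal functions. -/
theorem trace_equality {p r γ δ : ℝ} {f : ℝ × EuclideanSpace ℝ (Fin m) → ℝ}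
    (hm : 0 < m) (hp : 1 < p) (hpm : p < m + 1) (hC : IsCost (p / (p - 1)) C)
    (hr : r = p * m / (m + 1 - p)) (hδ : 0 < δ) (x₀ : EuclideanSpace ℝ (Fin m))
    (hf : ∀ t x, f (t, x) = γ * C (t + δ, x - x₀) ^ (-((m + 1 - p) / p))) :
    ((m + 1 - p) / p) ^ p / (m + 1 - p) * sliceIntegral C ^ ((p - 1) / m) *
        (∫ x, |f (0, x)| ^ r) ^ ((m + 1 - p) / m) =
      ∫ y in {y | 0 < y.1}, legendreP C (gradP f y) := by
  have hm' : (0 : ℝ) < m := Nat.cast_pos.2 hm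
  have hp0 : 0 < p := by linarith
  have hp1 : 0 < p - 1 := by linarith
  have hN : 0 < m + 1 - p := by linarith
  set B := sliceIntegral C with hB
  have hB0 : 0 < B := hC.sliceIntegral_pos hm
  have hqm : (p / (p - 1) - 1) * m - 1 = (m + 1 - p) / (p - 1) := by field_simp; ring
  have hbd : ∫ x, |f (0, x)| ^ r = |γ| ^ r * (δ ^ (-((p / (p - 1) - 1) * m)) * B) := by
    rw [← hC.integral_slice_translate hδ x₀, ← integral_const_mul]
    refine integral_congr_ae (Filter.Eventually.of_forall fun x => ?_)
    have hx : 0 < C (δ, x - x₀) := hC.pos_of_fst_ne_zero hδ.ne' _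
    simp only
    rw [hf, zero_add, abs_mul, abs_of_nonneg (rpow_nonneg hx.le _),
      mul_rpow (abs_nonneg _) (rpow_nonneg hx.le _), ← rpow_mul hx.le]
    congr 2
    rw [hr]
    field_simp
  have hae : ∫ y in {y : ℝ × EuclideanSpace ℝ (Fin m) | 0 < y.1}, legendreP C (gradP f y) =
      ∫ y in {y : ℝ × EuclideanSpace ℝ (Fin m) | 0 < y.1},
        |γ| ^ p * ((m + 1 - p) / p) ^ p / (p - 1) * C (y + (δ, -x₀)) ^ (-(m : ℝ)) := by
    refine setIntegral_congr_ae (measurableSet_lt measurable_const measurable_fst) ?_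
    filter_upwards [hC.ae_differentiableAt (δ, -x₀)] with y hd hy
    refine hC.legendreP_gradP_extremal hp hpm (fun y => ?_) hd
      (hC.pos_of_fst_ne_zero (add_pos hy hδ).ne' _)
    rw [← Prod.mk.eta (p := y), hf, Prod.mk_add_mk, sub_eq_add_neg]
  rw [hae, integral_const_mul, hC.integral_halfSpace_translate hm (by
    rw [← sub_pos, hqm]; positivity) hδ x₀, hbd, hqm, ← hB,
    mul_rpow (by positivity) (by positivity), mul_rpow (by positivity) hB0.le,
    ← rpow_mul (abs_nonneg _), ← rpow_mul hδ.le]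
  have h1 : r * ((m + 1 - p) / m) = p := by rw [hr]; field_simp
  have h2 : -((p / (p - 1) - 1) * m) * ((m + 1 - p) / m) = 1 - (p / (p - 1) - 1) * m := by
    field_simp; ring
  have h3 : B ^ ((p - 1) / m) * B ^ ((m + 1 - p) / m) = B := by
    rw [← rpow_add hB0, ← add_div, show p - 1 + (m + 1 - p) = (m : ℝ) by ring, div_self hm'.ne',
      rpow_one]
  rw [h1, h2]
  calc _ = ((m + 1 - p) / p) ^ p / (m + 1 - p) * |γ| ^ p * δ ^ (1 - (p / (p - 1) - 1) * m) *
        (B ^ ((p - 1) / m) * B ^ ((m + 1 - p) / m)) := by ring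
    _ = _ := by
      rw [h3]
      field_simp

end IsCost

theorem trace_constant_mul {p q m N B : ℝ} (hp : 1 < p) (hq : q = p / (p - 1)) (hm : 0 < m)
    (hN : 0 < N) (hB : 0 < B) :
    p ^ p * N ^ (-(p / q)) * (q * m) ^ (-(p / (q * m))) * (B / (q * m)) ^ (-(p / (q * m))) *
      ((N / p) ^ p / N * B ^ ((p - 1) / m)) = 1 := by
  have hp0 : 0 < p := by linarith
  have hp1 : 0 < p - 1 := by linarith
  have hq0 : 0 < q := by rw [hq]; positivity
  have h1 : p / q = p - 1 := by rw [hq]; field_simp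
  rw [← div_div p q m, h1, mul_assoc (p ^ p * N ^ (-(p - 1))), ← mul_rpow (by positivity)
    (by positivity), mul_div_cancel₀ _ (by positivity), rpow_neg hB.le, rpow_neg hN.le,
    rpow_sub_one hN.ne', div_rpow hN.le hp0.le]
  field_simp

/-- **Sharp anisotropic `L^p` Sobolev trace inequality (Nazaret).**  For `1 < p < n`,
`q = p/(p-1)` and `C` even, convex, `q`-homogeneous and positive away from `0`, every smooth
compactly supported `f` satisfies the trace inequality with the explicit constant `𝒦_{n,C}`;
moreover (extending both sides to all functions for which they are finite) equality holds for
`f(t,x) = γ C(t+δ, x−x₀)^{-(n-p)/p}` whenever `δ > 0`. -/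
theorem sharp_anisotropic_Lp_sobolev_trace (n : ℕ) (hn : 3 ≤ n) (p q : ℝ) (hp : 1 < p)
    (hpn : p < n) (hq : q = p / (p - 1))
    (C : ℝ × EuclideanSpace ℝ (Fin (n - 1)) → ℝ)
    (hC0 : ∀ y, 0 ≤ C y) (hCeven : ∀ y, C (-y) = C y) (hCconvex : ConvexOn ℝ Set.univ C)
    (hChom : ∀ l : ℝ, 0 ≤ l → ∀ y, C (l • y) = l ^ q * C y)
    (hCpos : ∀ y, y ≠ 0 → 0 < C y) :
    (∀ f : ℝ × EuclideanSpace ℝ (Fin (n - 1)) → ℝ, ContDiff ℝ (⊤ : ℕ∞) f → HasCompactSupport f →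
      bdry n (p * ((n : ℝ) - 1) / ((n : ℝ) - p)) f ^ (((n : ℝ) - p) / ((n : ℝ) - 1)) ≤
        (p ^ p * ((n : ℝ) - p) ^ (-(p / q)) *
            (q * ((n : ℝ) - 1)) ^ (-(p / (q * ((n : ℝ) - 1)))) *
            (∫ y in ({y | C y ≤ 1} ∩ H n), y.1 ^ (q * (n : ℝ) - q - (n : ℝ))) ^
              (-(p / (q * ((n : ℝ) - 1))))) *
          ∫ y in H n, legendreP C (dt f y, gradx f y)) ∧
    (∀ (γ δ : ℝ), 0 < δ → ∀ x₀ : EuclideanSpace ℝ (Fin (n - 1)),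
      ∀ f : ℝ × EuclideanSpace ℝ (Fin (n - 1)) → ℝ,
        (∀ (t : ℝ) (x : EuclideanSpace ℝ (Fin (n - 1))),
          f (t, x) = γ * C (t + δ, x - x₀) ^ (-(((n : ℝ) - p) / p))) →
        bdry n (p * ((n : ℝ) - 1) / ((n : ℝ) - p)) f ^ (((n : ℝ) - p) / ((n : ℝ) - 1)) =
          (p ^ p * ((n : ℝ) - p) ^ (-(p / q)) *
              (q * ((n : ℝ) - 1)) ^ (-(p / (q * ((n : ℝ) - 1)))) *
              (∫ y in ({y | C y ≤ 1} ∩ H n), y.1 ^ (q * (n : ℝ) - q - (n : ℝ))) ^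
                (-(p / (q * ((n : ℝ) - 1))))) *
            ∫ y in H n, legendreP C (dt f y, gradx f y)) := by
  have hm : 0 < n - 1 := by omega
  have hcast : ((n - 1 : ℕ) : ℝ) = n - 1 := by rw [Nat.cast_sub (by omega), Nat.cast_one]
  have hn' : (0 : ℝ) < n - 1 := by rw [← hcast]; exact_mod_cast hm
  have hN : ((n - 1 : ℕ) : ℝ) + 1 - p = n - p := by rw [hcast, sub_add_cancel]
  have hpm : p < ((n - 1 : ℕ) : ℝ) + 1 := by rwa [hcast, sub_add_cancel]
  have hr : p * ((n : ℝ) - 1) / (n - p) = p * ((n - 1 : ℕ) : ℝ) / (((n - 1 : ℕ) : ℝ) + 1 - p) := by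
    rw [hN, hcast]
  have hq1 : 1 < q := by rw [hq, one_lt_div (by linarith)]; linarith
  have hC : IsCost q C := ⟨hq1, hC0, hCeven, hCconvex, hChom, hCpos⟩
  have hI : ∫ y in ({y | C y ≤ 1} ∩ H n), y.1 ^ (q * (n : ℝ) - q - (n : ℝ)) =
      sliceIntegral C / (q * ((n : ℝ) - 1)) := by
    rw [← hcast, ← hC.integral_sublevel hm, hcast,
      show q * ((n : ℝ) - 1) - (n - 1) - 1 = q * n - q - n by ring]
    rfl
  have hK := trace_constant_mul hp hq hn' (sub_pos.2 hpn) (hC.sliceIntegral_pos hm)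
  rw [hI]
  set K := p ^ p * ((n : ℝ) - p) ^ (-(p / q)) *
      (q * ((n : ℝ) - 1)) ^ (-(p / (q * ((n : ℝ) - 1)))) *
    (sliceIntegral C / (q * ((n : ℝ) - 1))) ^ (-(p / (q * ((n : ℝ) - 1))))
  have hB := hC.sliceIntegral_pos hm
  have hq0 : 0 < q := hC.q_pos
  have hK0 : 0 < K := by
    have := sub_pos.2 hpn
    positivity
  have hC' : IsCost (p / (p - 1)) C := hq ▸ hC
  refine ⟨fun f hf hfs => ?_, fun γ δ hδ x₀ f hf => ?_⟩
  · have key := hC'.trace_inequality hm hp hpm hr (hf.of_le (by exact_mod_cast le_top)) hfs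
    rw [hN, hcast] at key
    have := mul_le_mul_of_nonneg_left key hK0.le
    rwa [← mul_assoc, hK, one_mul] at this
  · have key := hC'.trace_equality (γ := γ) (f := f) hm hp hpm hr hδ x₀ (by rwa [hN])
    rw [hN, hcast] at key
    have := congrArg (K * ·) key
    rwa [← mul_assoc, hK, one_mul] at this

end AffineTrace
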